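/- There is a universal constant C such that: in every directed polymatroidal network on n nodes whose polymatroids ρ_v⁻, ρ_v⁺ are all integer valued, for any multicommodity flow instance with k source-sink pairs, if β is the value of the maximum throughput multicommodity flow, then there exists a feasible multicut F with ν(F) ≤ C·β². -/

import Mathlib

open Finset MeasureTheory
open scoped ENNReal Classical

/-- A directed polymatroidal network: a finite directed graph together with,
for each node `v`, polymatroids `rhoM v` on the edges entering `v` and
`rhoP v` on the edges leaving `v`. -/
structure DirPolyNet (V E : Type) [Fintype V] [Fintype E] [DecidableEq V] [DecidableEq E] where
  tail : E → V
  head : E → V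
  rhoM : V → Finset E → ℝ
  rhoP : V → Finset E → ℝ
  rhoM_empty : ∀ v, rhoM v ∅ = 0
  rhoP_empty : ∀ v, rhoP v ∅ = 0
  rhoM_nonneg : ∀ v A, A ⊆ Finset.univ.filter (fun e => head e = v) → 0 ≤ rhoM v A
  rhoP_nonneg : ∀ v A, A ⊆ Finset.univ.filter (fun e => tail e = v) → 0 ≤ rhoP v A
  rhoM_mono : ∀ v A B, A ⊆ B → B ⊆ Finset.univ.filter (fun e => head e = v) →
    rhoM v A ≤ rhoM v B
  rhoP_mono : ∀ v A B, A ⊆ B → B ⊆ Finset.univ.filter (fun e => tail e = v) →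
    rhoP v A ≤ rhoP v B
  rhoM_submod : ∀ v A B, A ⊆ Finset.univ.filter (fun e => head e = v) →
    B ⊆ Finset.univ.filter (fun e => head e = v) →
    rhoM v (A ∪ B) + rhoM v (A ∩ B) ≤ rhoM v A + rhoM v B
  rhoP_submod : ∀ v A B, A ⊆ Finset.univ.filter (fun e => tail e = v) →
    B ⊆ Finset.univ.filter (fun e => tail e = v) →
    rhoP v (A ∪ B) + rhoP v (A ∩ B) ≤ rhoP v A + rhoP v B

namespace DirPolyNet

variable {V E : Type} [Fintype V] [Fintype E] [DecidableEq V] [DecidableEq E]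

/-- The set of edges entering `v` (the ground set of `rhoM v`). -/
def inE (N : DirPolyNet V E) (v : V) : Finset E :=
  Finset.univ.filter (fun e => N.head e = v)

/-- The set of edges leaving `v` (the ground set of `rhoP v`). -/
def outE (N : DirPolyNet V E) (v : V) : Finset E :=
  Finset.univ.filter (fun e => N.tail e = v)

/-- `g` is a valid assignment of the edges of `F` to endpoints. -/
def Valid (N : DirPolyNet V E) (F : Finset E) (g : E → V) : Prop :=
  ∀ e ∈ F, g e = N.tail e ∨ g e = N.head e

/-- The cost `ν(F)` of the edge cut `F`: the minimum over valid assignments `g`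
of `Σ_v (ρ⁻_v(δ⁻(v) ∩ g⁻¹(v)) + ρ⁺_v(δ⁺(v) ∩ g⁻¹(v)))`. -/
noncomputable def cutCost (N : DirPolyNet V E) (F : Finset E) : ℝ :=
  sInf { c : ℝ | ∃ g : E → V, N.Valid F g ∧
    c = ∑ v : V, (N.rhoM v ((N.inE v ∩ F).filter (fun e => g e = v)) +
                  N.rhoP v ((N.outE v ∩ F).filter (fun e => g e = v))) }

/-- `IsWalk N s t p`: the list of edges `p` forms a directed walk from `s` to `t`. -/
def IsWalk (N : DirPolyNet V E) : V → V → List E → Prop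
  | s, t, [] => s = t
  | s, t, e :: p => N.tail e = s ∧ IsWalk N (N.head e) t p

/-- The list of vertices visited by a walk starting at `s`. -/
def walkVerts (N : DirPolyNet V E) : V → List E → List V
  | s, [] => [s]
  | s, e :: p => s :: walkVerts N (N.head e) p

/-- A simple directed path from `s` to `t`. -/
def IsPath (N : DirPolyNet V E) (s t : V) (p : List E) : Prop :=
  N.IsWalk s t p ∧ (N.walkVerts s p).Nodup

/-- `F` separates the ordered pair `(s,t)`: there is no `s→t` path avoiding `F`. -/
def Separates (N : DirPolyNet V E) (F : Finset E) (s t : V) : Prop :=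
  ¬ ∃ p : List E, N.IsWalk s t p ∧ ∀ e ∈ p, e ∉ F

/-- Total flow on an edge `e`. -/
noncomputable def edgeFlow (N : DirPolyNet V E) {ι : Type} [Fintype ι]
    (f : ι → List E → ℝ) (e : E) : ℝ :=
  ∑ i : ι, ∑ᶠ p ∈ {p : List E | e ∈ p}, f i p

/-- The rate of commodity `i`. -/
noncomputable def rate {ι : Type} (f : ι → List E → ℝ) (i : ι) : ℝ :=
  ∑ᶠ p : List E, f i p

/-- A feasible multicommodity flow for the source-sink pairs `(s i, t i)`. -/
structure IsFlow (N : DirPolyNet V E) {ι : Type} [Fintype ι] (s t : ι → V)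
    (f : ι → List E → ℝ) : Prop where
  nonneg : ∀ i p, 0 ≤ f i p
  supp : ∀ i p, f i p ≠ 0 → N.IsPath (s i) (t i) p
  fin : ∀ i, (Function.support (f i)).Finite
  capM : ∀ v, ∀ S ⊆ N.inE v, ∑ e ∈ S, N.edgeFlow f e ≤ N.rhoM v S
  capP : ∀ v, ∀ S ⊆ N.outE v, ∑ e ∈ S, N.edgeFlow f e ≤ N.rhoP v S

/-- `D(F)`: the total demand of the pairs separated by `F`. -/
noncomputable def sepDemand (N : DirPolyNet V E) {ι : Type} [Fintype ι]
    (s t : ι → V) (D : ι → ℝ) (F : Finset E) : ℝ :=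
  ∑ i : ι, if N.Separates F (s i) (t i) then D i else 0

/-- The value of the maximum throughput multicommodity flow. -/
noncomputable def maxThroughput (N : DirPolyNet V E) {ι : Type} [Fintype ι]
    (s t : ι → V) : ℝ :=
  sSup { r : ℝ | ∃ f : ι → List E → ℝ, N.IsFlow s t f ∧ r = ∑ i : ι, rate f i }

/-- The value of the maximum concurrent multicommodity flow for demands `D`. -/
noncomputable def maxConcurrent (N : DirPolyNet V E) {ι : Type} [Fintype ι]
    (s t : ι → V) (D : ι → ℝ) : ℝ :=
  sSup { lam : ℝ | ∃ f : ι → List E → ℝ, N.IsFlow s t f ∧ ∀ i, rate f i = lam * D i }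

end DirPolyNet

open DirPolyNet

namespace DirPolyNet

/-- Weak form of linear programming duality: if every nonnegative `x` with `M x ≤ b` has total
mass at most `β`, there is a fractional cover `y` of cost at most `2 β + 1 / 2`. -/
theorem exists_fractional_cover {J P : Type} [Fintype J] [Fintype P] (M : J → P → ℝ) (b : J → ℝ)
    (hb : ∀ j, 0 < b j) (β : ℝ) (hβ : 0 ≤ β)
    (h : ∀ x : P → ℝ, (∀ p, 0 ≤ x p) → (∀ j, ∑ p, M j p * x p ≤ b j) → ∑ p, x p ≤ β) :
    ∃ y : J → ℝ, (∀ j, 0 ≤ y j) ∧ ∑ j, y j * b j ≤ 2 * β + 1 / 2 ∧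
      ∀ p, 1 ≤ ∑ j, y j * M j p := by
  let A : Set ((J → ℝ) × ℝ) := {w | (∀ j, w.1 j < b j) ∧ β < w.2}
  let L : (P → ℝ) →ₗ[ℝ] ((J → ℝ) × ℝ) :=
    { toFun := fun x => (fun j => ∑ p, M j p * x p, ∑ p, x p)
      map_add' := by
        intro x x'
        ext <;> simp [mul_add, Finset.sum_add_distrib]
      map_smul' := by
        intro c x
        ext <;> simp [Finset.mul_sum, mul_left_comm] }
  let B : Set ((J → ℝ) × ℝ) := L '' {x | ∀ p, 0 ≤ x p}
  have hAc : Convex ℝ A := by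
    have : A = (⋂ j, {w : (J → ℝ) × ℝ | w.1 j < b j}) ∩ {w | β < w.2} := by
      ext w; simp [A]
    rw [this]
    refine (convex_iInter fun j => ?_).inter ?_
    · exact convex_halfSpace_lt ⟨fun _ _ => rfl, fun _ _ => rfl⟩ _
    · exact convex_halfSpace_gt ⟨fun _ _ => rfl, fun _ _ => rfl⟩ _
  have hAo : IsOpen A := by
    have : A = (⋂ j, {w : (J → ℝ) × ℝ | w.1 j < b j}) ∩ {w | β < w.2} := by
      ext w; simp [A]
    rw [this]
    refine (isOpen_iInter_of_finite fun j => ?_).inter ?_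
    · exact isOpen_lt (by fun_prop) continuous_const
    · exact isOpen_lt continuous_const (by fun_prop)
  have hBc : Convex ℝ B := by
    refine Convex.linear_image ?_ L
    intro x hx x' hx' c c' hc hc' _ p
    exact add_nonneg (mul_nonneg hc (hx p)) (mul_nonneg hc' (hx' p))
  have hdisj : Disjoint A B := by
    rw [Set.disjoint_left]
    rintro _ ⟨h1, h2⟩ ⟨x, hx, rfl⟩
    exact absurd (h x hx fun j => (h1 j).le) (not_le.2 h2)
  obtain ⟨f, u, hfA, hfB⟩ := geometric_hahn_banach_open hAc hAo hBc hdisj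
  let y : J → ℝ := fun j => f (Pi.single j 1, 0)
  let q : ℝ := - f (0, 1)
  have hf : ∀ z r, f (z, r) = ∑ j, y j * z j - q * r := by
    intro z r
    have h1 : (z, r) = ∑ j, z j • ((Pi.single j 1, 0) : (J → ℝ) × ℝ) + r • (0, 1) := by
      ext i
      · simp [Prod.fst_sum, Finset.sum_apply, Pi.single_apply]
      · simp [Prod.snd_sum]
    rw [h1, map_add, map_sum]
    simp only [map_smul, smul_eq_mul, y, q]
    simp [mul_comm]
  have hu : u ≤ 0 := by
    have := hfB 0 ⟨0, by simp, by simp⟩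
    simpa using this
  have hneg : ∀ (z : J → ℝ) (r : ℝ), (∀ j, z j < b j) → β < r → ∑ j, y j * z j - q * r < 0 := by
    intro z r hz hr
    rw [← hf]
    exact (hfA (z, r) ⟨hz, hr⟩).trans_le hu
  have hray : ∀ c d : ℝ, (∀ K : ℝ, 0 ≤ K → c - K * d < 0) → 0 ≤ d := by
    intro c d hcd
    by_contra! hd
    have := hcd (|c| / (-d)) (by have := abs_nonneg c; have : 0 < -d := by linarith
                                 positivity)
    have h2 : |c| / (-d) * d = -|c| := by
      rw [div_neg, neg_mul, div_mul_cancel₀ _ hd.ne]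
    have := neg_abs_le c
    linarith
  have hy : ∀ j, 0 ≤ y j := by
    intro j
    refine hray (∑ j, y j * (b j / 2) - q * (β + 1)) _ fun K hK => ?_
    have := hneg (fun i => b i / 2 - K * (if i = j then 1 else 0)) (β + 1) (fun i => by
      have := hb i
      have : 0 ≤ K * (if i = j then (1 : ℝ) else 0) := by positivity
      linarith) (by linarith)
    have h2 : ∑ i, y i * (b i / 2 - K * (if i = j then 1 else 0)) =
        ∑ i, y i * (b i / 2) - K * y j := by
      simp only [mul_sub, Finset.sum_sub_distrib]
      simp [mul_comm]
    linarith
  have hmain : ∑ j, y j * (b j / 2) < q * (β + 1 / 4) := by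
    have := hneg (fun i => b i / 2) (β + 1 / 4) (fun i => by have := hb i; linarith) (by linarith)
    linarith
  have hyb : 0 ≤ ∑ j, y j * (b j / 2) :=
    Finset.sum_nonneg fun j _ => mul_nonneg (hy j) (by have := hb j; linarith)
  have hq : 0 < q := by
    by_contra! hq
    nlinarith
  refine ⟨fun j => y j / q, fun j => div_nonneg (hy j) hq.le, ?_, fun p => ?_⟩
  · have h2 : ∑ j, y j / q * b j = 2 / q * ∑ j, y j * (b j / 2) := by
      rw [Finset.mul_sum]
      exact Finset.sum_congr rfl fun j _ => by ring
    have h3 : 2 / q * ∑ j, y j * (b j / 2) ≤ 2 / q * (q * (β + 1 / 4)) := by gcongr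
    have h4 : 2 / q * (q * (β + 1 / 4)) = 2 * β + 1 / 2 := by field_simp; ring
    linarith
  · have h2 : 0 ≤ ∑ j, y j * M j p - q := by
      refine hray (u - 1) _ fun K hK => ?_
      have := hfB (L (Pi.single p K)) ⟨_, fun i => by
        by_cases hi : i = p
        · subst hi; simpa using hK
        · simp [hi], rfl⟩
      have h3 : L (Pi.single p K) = (fun j => M j p * K, K) := by
        ext <;> simp [L, Pi.single_apply]
      rw [h3, hf] at this
      have h4 : ∑ j, y j * (M j p * K) = K * ∑ j, y j * M j p := by
        rw [Finset.mul_sum]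
        exact Finset.sum_congr rfl fun j _ => by ring
      rw [h4] at this
      linarith
    have h3 : ∑ j, y j / q * M j p = (∑ j, y j * M j p) / q := by
      rw [Finset.sum_div]
      exact Finset.sum_congr rfl fun j _ => by ring
    rw [h3, le_div_iff₀ hq]
    linarith

/-- Greedy vectors: for a polymatroid `ρ` on `U` and a weight `a`, some nonnegative vector of the
polymatroid is tight on all superlevel sets of `a`. -/
theorem exists_greedy {E : Type} [DecidableEq E] (ρ : Finset E → ℝ) (a : E → ℝ) (U : Finset E)
    (h0 : ρ ∅ = 0) (hmono : ∀ A B, A ⊆ B → B ⊆ U → ρ A ≤ ρ B)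
    (hsub : ∀ A B, A ⊆ U → B ⊆ U → ρ (A ∪ B) + ρ (A ∩ B) ≤ ρ A + ρ B) :
    ∃ g : E → ℝ, (∀ e, 0 ≤ g e) ∧ (∀ S ⊆ U, ∑ e ∈ S, g e ≤ ρ S) ∧
      ∀ θ : ℝ, ∑ e ∈ U.filter (fun e => θ ≤ a e), g e = ρ (U.filter (fun e => θ ≤ a e)) := by
  induction U using Finset.induction_on_min_value a with
  | empty => exact ⟨fun _ => 0, fun _ => le_rfl, fun S hS => by simp [Finset.subset_empty.1 hS, h0],
      fun θ => by simp [h0]⟩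
  | insert m U hm hmin ih =>
    have hU : U ⊆ insert m U := Finset.subset_insert m U
    obtain ⟨g, hg, hS, hθ⟩ := ih (fun A B h h' => hmono A B h (h'.trans hU))
      (fun A B h h' => hsub A B (h.trans hU) (h'.trans hU))
    have hupd : ∀ S : Finset E, m ∉ S →
        ∑ e ∈ S, Function.update g m (ρ (insert m U) - ρ U) e = ∑ e ∈ S, g e := by
      intro S hmS
      refine Finset.sum_congr rfl fun e he => ?_
      exact Function.update_of_ne (fun h => hmS (by rwa [h] at he)) _ _
    refine ⟨Function.update g m (ρ (insert m U) - ρ U), fun e => ?_, fun S hSU => ?_, fun θ => ?_⟩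
    · by_cases he : e = m
      · subst he
        simpa using hmono _ _ hU le_rfl
      · simpa [he] using hg e
    · by_cases hmS : m ∈ S
      · have hS' : S.erase m ⊆ U := by
          intro e he
          rw [Finset.mem_erase] at he
          exact (Finset.mem_insert.1 (hSU he.2)).resolve_left he.1
        rw [← Finset.insert_erase hmS, Finset.sum_insert (Finset.notMem_erase m S),
          hupd _ (Finset.notMem_erase m S), Finset.insert_erase hmS, Function.update_self]
        have h1 := hS _ hS'
        have h2 := hsub S U hSU hU
        have h3 : S ∪ U = insert m U := by
          ext e
          simp only [Finset.mem_union, Finset.mem_insert]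
          constructor
          · rintro (h | h)
            · exact Finset.mem_insert.1 (hSU h)
            · exact Or.inr h
          · rintro (rfl | h)
            · exact Or.inl hmS
            · exact Or.inr h
        have h4 : S ∩ U = S.erase m := by
          ext e
          simp only [Finset.mem_inter, Finset.mem_erase]
          constructor
          · rintro ⟨h, h'⟩
            exact ⟨fun h'' => hm (by rwa [h''] at h'), h⟩
          · rintro ⟨h, h'⟩
            exact ⟨h', hS' (Finset.mem_erase.2 ⟨h, h'⟩)⟩
        rw [h3, h4] at h2
        linarith
      · rw [hupd S hmS]
        exact hS S fun e he => (Finset.mem_insert.1 (hSU he)).resolve_left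
          fun h => hmS (by rwa [h] at he)
    · by_cases hθm : θ ≤ a m
      · have h1 : ∀ x ∈ U, θ ≤ a x := fun x hx => hθm.trans (hmin x hx)
        have h2 := hθ θ
        rw [Finset.filter_true_of_mem h1] at h2
        rw [Finset.filter_insert, if_pos hθm, Finset.filter_true_of_mem h1,
          Finset.sum_insert hm, hupd U hm, h2, Function.update_self]
        ring
      · rw [Finset.filter_insert, if_neg hθm, hupd _ (fun h => hm (Finset.mem_filter.1 h).1)]
        exact hθ θ

/-- Averaging over levels `r ∈ [1/3, 2/3]`: some level meets weighted intervals of total weight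
at most three times their weighted length. -/
theorem exists_level {I : Type} [Fintype I] (w l c : I → ℝ) (hw : ∀ i, 0 ≤ w i)
    (hc : ∀ i, 0 ≤ c i) :
    ∃ r : ℝ, 1 / 3 ≤ r ∧ r ≤ 2 / 3 ∧
      ∑ i, w i * (if l i ≤ r ∧ r ≤ l i + c i then 1 else 0) ≤ 3 * ∑ i, w i * c i := by
  let F : I → ℝ → ℝ := fun i => (Set.Icc (l i) (l i + c i)).indicator fun _ => w i
  have hF : ∀ i, IntegrableOn (F i) (Set.Icc (1 / 3) (2 / 3)) := fun i =>
    Integrable.indicator (integrableOn_const (by simp)) measurableSet_Icc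
  have hFi : ∀ i, ∫ r in Set.Icc (1 / 3) (2 / 3), F i r ≤ w i * c i := by
    intro i
    rw [setIntegral_indicator measurableSet_Icc, setIntegral_const, smul_eq_mul, mul_comm]
    refine mul_le_mul_of_nonneg_left ?_ (hw i)
    have h1 : volume.real (Set.Icc (1 / 3) (2 / 3) ∩ Set.Icc (l i) (l i + c i)) ≤
        volume.real (Set.Icc (l i) (l i + c i)) :=
      measureReal_mono Set.inter_subset_right (by simp)
    refine h1.trans ?_
    rw [Real.volume_real_Icc_of_le (by linarith [hc i])]
    linarith
  obtain ⟨r, hr, hle⟩ := exists_le_setAverage (μ := volume) (s := Set.Icc (1 / 3 : ℝ) (2 / 3))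
    (f := fun r => ∑ i, F i r) (by simp; norm_num) (by simp)
    (integrable_finsetSum _ fun i _ => hF i)
  refine ⟨r, hr.1, hr.2, ?_⟩
  rw [setAverage_eq, integral_finsetSum _ fun i _ => hF i,
    Real.volume_real_Icc_of_le (by norm_num), smul_eq_mul] at hle
  have h1 : ∑ i, F i r = ∑ i, w i * (if l i ≤ r ∧ r ≤ l i + c i then 1 else 0) :=
    Finset.sum_congr rfl fun i _ => by simp [F, Set.indicator_apply]
  have h2 := Finset.sum_le_sum fun i (_ : i ∈ Finset.univ) => hFi i
  rw [← h1]
  have h3 : ((2 / 3 : ℝ) - 1 / 3)⁻¹ = 3 := by norm_num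
  rw [h3] at hle
  linarith

theorem sdiff_union_union_union {E : Type} [DecidableEq E] (G X X' Y Y' : Finset E) :
    G \ (X ∪ X' ∪ (Y ∪ Y')) = (G \ (X ∪ Y)) \ (X' ∪ Y') := by
  ext e
  simp only [Finset.mem_sdiff, Finset.mem_union]
  tauto

variable {V E : Type} [Fintype V] [Fintype E] [DecidableEq V] [DecidableEq E]

/-- Some walk from `u` to `v` uses only edges of `G`. -/
def Conn (N : DirPolyNet V E) (G : Finset E) (u v : V) : Prop :=
  ∃ p, N.IsWalk u v p ∧ ∀ e ∈ p, e ∈ G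

theorem IsWalk.append {N : DirPolyNet V E} {v w : V} {q : List E} (hq : N.IsWalk v w q) :
    ∀ {p : List E} {u : V}, N.IsWalk u v p → N.IsWalk u w (p ++ q)
  | [], _, hp => by
    obtain rfl : _ = v := hp
    exact hq
  | _ :: _, _, hp => ⟨hp.1, IsWalk.append hq hp.2⟩

theorem Conn.refl (N : DirPolyNet V E) (G : Finset E) (u : V) : N.Conn G u u :=
  ⟨[], rfl, by simp⟩

theorem Conn.trans {N : DirPolyNet V E} {G : Finset E} {u v w : V} (h : N.Conn G u v)
    (h' : N.Conn G v w) : N.Conn G u w := by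
  obtain ⟨p, hp, hpG⟩ := h
  obtain ⟨q, hq, hqG⟩ := h'
  refine ⟨p ++ q, hq.append hp, fun e he => ?_⟩
  rcases List.mem_append.1 he with h | h
  exacts [hpG e h, hqG e h]

theorem Conn.edge {N : DirPolyNet V E} {G : Finset E} {e : E} (he : e ∈ G) :
    N.Conn G (N.tail e) (N.head e) :=
  ⟨[e], ⟨rfl, rfl⟩, by simpa using he⟩

theorem Conn.mono {N : DirPolyNet V E} {G G' : Finset E} (h : G ⊆ G') {u v : V}
    (hc : N.Conn G u v) : N.Conn G' u v := by
  obtain ⟨p, hp, hpG⟩ := hc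
  exact ⟨p, hp, fun e he => h (hpG e he)⟩

theorem walkVerts_eq (N : DirPolyNet V E) : ∀ (p : List E) (s : V),
    N.walkVerts s p = s :: p.map N.head
  | [], _ => rfl
  | e :: p, s => by simp [walkVerts, walkVerts_eq N p]

theorem IsPath.nodup {N : DirPolyNet V E} {s t : V} {p : List E} (hp : N.IsPath s t p) :
    p.Nodup := by
  have := hp.2
  rw [walkVerts_eq] at this
  exact this.tail.of_map

theorem IsPath.head_ne_tail {N : DirPolyNet V E} : ∀ {p : List E} {s t : V}, N.IsPath s t p →
    ∀ e ∈ p, N.head e ≠ N.tail e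
  | [], _, _, _ => by simp
  | e :: p, s, t, hp => by
    have h2 : (s :: N.walkVerts (N.head e) p).Nodup := hp.2
    rw [List.nodup_cons] at h2
    intro f hf
    rcases List.mem_cons.1 hf with rfl | hf
    · rw [hp.1.1]
      intro h
      refine h2.1 ?_
      rw [walkVerts_eq, h]
      exact List.mem_cons_self
    · exact IsPath.head_ne_tail ⟨hp.1.2, h2.2⟩ f hf

theorem IsPath.exists_suffix {N : DirPolyNet V E} : ∀ {p : List E} {u s t : V},
    N.IsPath u t p → s ∈ N.walkVerts u p → ∃ q, N.IsPath s t q ∧ q.Sublist p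
  | [], u, s, t, hp, hs => by
    obtain rfl : s = u := by simpa [walkVerts] using hs
    exact ⟨[], hp, List.Sublist.refl _⟩
  | e :: p, u, s, t, hp, hs => by
    rcases List.mem_cons.1 hs with rfl | hs
    · exact ⟨_, hp, List.Sublist.refl _⟩
    · obtain ⟨q, hq, hqp⟩ := IsPath.exists_suffix ⟨hp.1.2, (List.nodup_cons.1 hp.2).2⟩ hs
      exact ⟨q, hq, hqp.cons e⟩

theorem IsWalk.exists_path {N : DirPolyNet V E} : ∀ {p : List E} {s t : V},
    N.IsWalk s t p → ∃ q, N.IsPath s t q ∧ q.Sublist p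
  | [], s, t, hp => ⟨[], ⟨hp, by simp [walkVerts]⟩, List.Sublist.refl _⟩
  | e :: p, s, t, hp => by
    obtain ⟨q, hq, hqp⟩ := IsWalk.exists_path hp.2
    by_cases hs : s ∈ N.walkVerts (N.head e) q
    · obtain ⟨q', hq', hqq'⟩ := hq.exists_suffix hs
      exact ⟨q', hq', (hqq'.trans hqp).cons e⟩
    · exact ⟨e :: q, ⟨⟨hp.1, hq.1⟩, List.nodup_cons.2 ⟨hs, hq.2⟩⟩, hqp.cons_cons e⟩

theorem Conn.exists_path {N : DirPolyNet V E} {G : Finset E} {u v : V} (h : N.Conn G u v) :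
    ∃ p, N.IsPath u v p ∧ ∀ e ∈ p, e ∈ G := by
  obtain ⟨p, hp, hpG⟩ := h
  obtain ⟨q, hq, hqp⟩ := hp.exists_path
  exact ⟨q, hq, fun e he => hpG e (hqp.subset he)⟩

theorem IsWalk.conn_of_mem {N : DirPolyNet V E} {G : Finset E} : ∀ {p : List E} {u w : V},
    N.IsWalk u w p → (∀ e ∈ p, e ∈ G) → ∀ e ∈ p, N.Conn G u (N.tail e) ∧ N.Conn G (N.head e) w
  | [], _, _, _, _ => by simp
  | e :: p, u, w, hp, hpG => by
    have hpG' : ∀ f ∈ p, f ∈ G := fun f hf => hpG f (List.mem_cons_of_mem _ hf)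
    obtain ⟨rfl, hp⟩ := hp
    intro f hf
    rcases List.mem_cons.1 hf with rfl | hf
    · exact ⟨Conn.refl N G _, p, hp, hpG'⟩
    · obtain ⟨h1, h2⟩ := hp.conn_of_mem hpG' f hf
      exact ⟨(Conn.edge (hpG e List.mem_cons_self)).trans h1, h2⟩

theorem IsWalk.sum_le {N : DirPolyNet V E} {k : E → ℝ} {α γ : V → ℝ} (hγ : ∀ v, 0 ≤ γ v) :
    ∀ {p : List E} {u w : V}, N.IsWalk u w p →
      (∀ e ∈ p, k e ≤ α (N.head e) + γ (N.tail e)) →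
      (p.map k).sum + α u ≤ ((N.walkVerts u p).map fun v => α v + γ v).sum
  | [], u, w, _, _ => by simp [walkVerts, hγ u]
  | e :: p, u, w, hp, hk => by
    have ih := IsWalk.sum_le hγ hp.2 fun f hf => hk f (List.mem_cons_of_mem _ hf)
    have h1 := hk e List.mem_cons_self
    rw [hp.1] at h1
    simp only [List.map_cons, List.sum_cons, walkVerts]
    linarith

theorem IsPath.sum_le {N : DirPolyNet V E} {k : E → ℝ} {α γ : V → ℝ} (hα : ∀ v, 0 ≤ α v)
    (hγ : ∀ v, 0 ≤ γ v) {p : List E} {u w : V} (hp : N.IsPath u w p)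
    (hk : ∀ e ∈ p, k e ≤ α (N.head e) + γ (N.tail e)) :
    (p.map k).sum ≤ ∑ v, (α v + γ v) := by
  have h1 := IsWalk.sum_le hγ hp.1 hk
  rw [← List.sum_toFinset _ hp.2] at h1
  have h2 : ∑ v ∈ (N.walkVerts u p).toFinset, (α v + γ v) ≤ ∑ v, (α v + γ v) :=
    Finset.sum_le_sum_of_subset_of_nonneg (Finset.subset_univ _)
      fun v _ _ => add_nonneg (hα v) (hγ v)
  linarith [hα u]

theorem IsWalk.telescope {N : DirPolyNet V E} (h : V → ℝ) : ∀ {p : List E} {u w : V},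
    N.IsWalk u w p → (p.map fun e => h (N.head e) - h (N.tail e)).sum = h w - h u
  | [], u, w, hp => by
    obtain rfl : u = w := hp
    simp
  | e :: p, u, w, hp => by
    rw [List.map_cons, List.sum_cons, IsWalk.telescope h hp.2, hp.1]
    ring

/-- Distances from `s` in `G` for the edge lengths `ℓ`. -/
theorem exists_dist (N : DirPolyNet V E) (G : Finset E) {ℓ : E → ℝ} (hℓ : ∀ e, 0 ≤ ℓ e) {s t : V}
    (hst : N.Conn G s t)
    (hlong : ∀ p, N.IsPath s t p → (∀ e ∈ p, e ∈ G) → 1 ≤ (p.map ℓ).sum) :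
    ∃ d : V → ℝ, d s ≤ 0 ∧ 1 ≤ d t ∧
      ∀ e ∈ G, N.Conn G s (N.tail e) → d (N.head e) ≤ d (N.tail e) + ℓ e := by
  let D : V → Set ℝ := fun v => {x | ∃ p, N.IsWalk s v p ∧ (∀ e ∈ p, e ∈ G) ∧ x = (p.map ℓ).sum}
  have hbdd : ∀ v, BddBelow (D v) := by
    refine fun v => ⟨0, ?_⟩
    rintro _ ⟨p, -, -, rfl⟩
    refine List.sum_nonneg fun x hx => ?_
    obtain ⟨e, -, rfl⟩ := List.mem_map.1 hx
    exact hℓ e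
  refine ⟨fun v => sInf (D v), csInf_le (hbdd s) ⟨[], rfl, by simp, by simp⟩, ?_, ?_⟩
  · obtain ⟨p, hp, hpG⟩ := hst
    refine le_csInf ⟨_, p, hp, hpG, rfl⟩ ?_
    rintro _ ⟨p, hp, hpG, rfl⟩
    obtain ⟨q, hq, hqp⟩ := hp.exists_path
    refine (hlong q hq fun e he => hpG e (hqp.subset he)).trans ?_
    refine (hqp.map ℓ).sum_le_sum fun x hx => ?_
    obtain ⟨e, -, rfl⟩ := List.mem_map.1 hx
    exact hℓ e
  · rintro e he ⟨p, hp, hpG⟩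
    rw [← sub_le_iff_le_add]
    refine le_csInf ⟨_, p, hp, hpG, rfl⟩ ?_
    rintro _ ⟨p, hp, hpG, rfl⟩
    rw [sub_le_iff_le_add]
    have hw : N.IsWalk (N.tail e) (N.head e) [e] := ⟨rfl, rfl⟩
    refine csInf_le (hbdd _) ⟨p ++ [e], hw.append hp, fun f hf => ?_, by simp⟩
    rcases List.mem_append.1 hf with h | h
    · exact hpG f h
    · obtain rfl := List.mem_singleton.1 h
      exact he

/-- The cost of cutting the edges of `X` at their heads and the edges of `Y` at their tails. -/
noncomputable def splitCost (N : DirPolyNet V E) (X Y : Finset E) : ℝ :=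
  ∑ v, (N.rhoM v (N.inE v ∩ X) + N.rhoP v (N.outE v ∩ Y))

theorem mono_of_subset_inE (N : DirPolyNet V E) {v : V} {A B : Finset E} (h : A ⊆ B)
    (hB : B ⊆ N.inE v) : N.rhoM v A ≤ N.rhoM v B := N.rhoM_mono v A B h hB

theorem mono_of_subset_outE (N : DirPolyNet V E) {v : V} {A B : Finset E} (h : A ⊆ B)
    (hB : B ⊆ N.outE v) : N.rhoP v A ≤ N.rhoP v B := N.rhoP_mono v A B h hB

theorem rhoM_union_le (N : DirPolyNet V E) {v : V} {A B : Finset E} (hA : A ⊆ N.inE v)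
    (hB : B ⊆ N.inE v) : N.rhoM v (A ∪ B) ≤ N.rhoM v A + N.rhoM v B := by
  have h1 := N.rhoM_submod v A B hA hB
  have h2 := N.rhoM_nonneg v (A ∩ B) (Finset.inter_subset_left.trans hA)
  linarith

theorem rhoP_union_le (N : DirPolyNet V E) {v : V} {A B : Finset E} (hA : A ⊆ N.outE v)
    (hB : B ⊆ N.outE v) : N.rhoP v (A ∪ B) ≤ N.rhoP v A + N.rhoP v B := by
  have h1 := N.rhoP_submod v A B hA hB
  have h2 := N.rhoP_nonneg v (A ∩ B) (Finset.inter_subset_left.trans hA)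
  linarith

theorem splitCost_union_le (N : DirPolyNet V E) (X Y X' Y' : Finset E) :
    N.splitCost (X ∪ X') (Y ∪ Y') ≤ N.splitCost X Y + N.splitCost X' Y' := by
  unfold splitCost
  rw [← Finset.sum_add_distrib]
  refine Finset.sum_le_sum fun v _ => ?_
  rw [Finset.inter_union_distrib_left, Finset.inter_union_distrib_left]
  have h1 := N.rhoM_union_le (v := v) (A := N.inE v ∩ X) (B := N.inE v ∩ X')
    Finset.inter_subset_left Finset.inter_subset_left
  have h2 := N.rhoP_union_le (v := v) (A := N.outE v ∩ Y) (B := N.outE v ∩ Y')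
    Finset.inter_subset_left Finset.inter_subset_left
  linarith

/-- A split cut meeting every simple path yields a multicut that costs no more. -/
theorem exists_multicut_of_split (N : DirPolyNet V E) {ι : Type} (s t : ι → V) (X Y : Finset E)
    (h : ∀ i, ¬ N.Conn (Finset.univ \ (X ∪ Y)) (s i) (t i)) :
    ∃ F : Finset E, (∀ i, N.Separates F (s i) (t i)) ∧ N.cutCost F ≤ N.splitCost X Y := by
  refine ⟨(X ∪ Y).filter fun e => N.head e ≠ N.tail e, fun i => ?_, ?_⟩
  · rintro ⟨p, hp, hpF⟩
    obtain ⟨q, hq, hqp⟩ := hp.exists_path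
    refine h i ⟨q, hq.1, fun e he => ?_⟩
    have h1 := hpF e (hqp.subset he)
    have h2 := hq.head_ne_tail e he
    simp only [Finset.mem_filter, not_and, not_not] at h1
    exact Finset.mem_sdiff.2 ⟨Finset.mem_univ _, fun h3 => h2 (h1 h3)⟩
  · let g : E → V := fun e => if e ∈ X then N.head e else N.tail e
    have hM : ∀ v, N.rhoM v ((N.inE v ∩ ((X ∪ Y).filter fun e => N.head e ≠ N.tail e)).filter
        fun e => g e = v) ≤
        N.rhoM v (N.inE v ∩ X) := by
      intro v
      refine N.mono_of_subset_inE (fun e he => ?_) Finset.inter_subset_left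
      simp only [Finset.mem_filter, Finset.mem_inter, inE, Finset.mem_univ, true_and, g] at he ⊢
      refine ⟨he.1.1, ?_⟩
      by_contra hX
      rw [if_neg hX] at he
      exact he.1.2.2 (he.1.1.trans he.2.symm)
    have hP : ∀ v, N.rhoP v ((N.outE v ∩ ((X ∪ Y).filter fun e => N.head e ≠ N.tail e)).filter
        fun e => g e = v) ≤
        N.rhoP v (N.outE v ∩ Y) := by
      intro v
      refine N.mono_of_subset_outE (fun e he => ?_) Finset.inter_subset_left
      simp only [Finset.mem_filter, Finset.mem_inter, outE, Finset.mem_univ, true_and, g] at he ⊢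
      refine ⟨he.1.1, ?_⟩
      by_cases hX : e ∈ X
      · rw [if_pos hX] at he
        exact absurd (he.2.trans he.1.1.symm) he.1.2.2
      · exact (Finset.mem_union.1 he.1.2.1).resolve_left hX
    have hg : N.cutCost ((X ∪ Y).filter fun e => N.head e ≠ N.tail e) ≤ _ :=
      csInf_le ?_ ⟨g, ?_, rfl⟩
    · exact hg.trans (Finset.sum_le_sum fun v _ => add_le_add (hM v) (hP v))
    · refine ⟨0, ?_⟩
      rintro _ ⟨g, -, rfl⟩
      refine Finset.sum_nonneg fun v _ => add_nonneg ?_ ?_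
      · exact N.rhoM_nonneg v _ ((Finset.filter_subset _ _).trans Finset.inter_subset_left)
      · exact N.rhoP_nonneg v _ ((Finset.filter_subset _ _).trans Finset.inter_subset_left)
    · intro e _
      by_cases he : e ∈ X
      · right; simp [g, he]
      · left; simp [g, he]
theorem sum_inE (N : DirPolyNet V E) (U : Finset E) (φ : E → ℝ) :
    ∑ v, ∑ e ∈ N.inE v ∩ U, φ e = ∑ e ∈ U, φ e := by
  rw [← Finset.sum_fiberwise U N.head φ]
  refine Finset.sum_congr rfl fun v _ => Finset.sum_congr ?_ fun _ _ => rfl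
  ext e
  simp [inE, and_comm]

theorem sum_outE (N : DirPolyNet V E) (U : Finset E) (φ : E → ℝ) :
    ∑ v, ∑ e ∈ N.outE v ∩ U, φ e = ∑ e ∈ U, φ e := by
  rw [← Finset.sum_fiberwise U N.tail φ]
  refine Finset.sum_congr rfl fun v _ => Finset.sum_congr ?_ fun _ _ => rfl
  ext e
  simp [outE, and_comm]

/-- Edge lengths `a + b` on `U`, with greedy vectors `gM`, `gP` that compute the cost of the
superlevel sets of `a` and `b`, and the resulting vertex masses `μM`, `μP`. -/
structure IsCover (N : DirPolyNet V E) (U : Finset E) (a b gM gP : E → ℝ) (μM μP : V → ℝ) :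
    Prop where
  a_nonneg : ∀ e, 0 ≤ a e
  b_nonneg : ∀ e, 0 ≤ b e
  gM_nonneg : ∀ e, 0 ≤ gM e
  gP_nonneg : ∀ e, 0 ≤ gP e
  levelM : ∀ v (θ : ℝ), N.rhoM v ((N.inE v ∩ U).filter fun e => θ ≤ a e) =
    ∑ e ∈ (N.inE v ∩ U).filter fun e => θ ≤ a e, gM e
  levelP : ∀ v (θ : ℝ), N.rhoP v ((N.outE v ∩ U).filter fun e => θ ≤ b e) =
    ∑ e ∈ (N.outE v ∩ U).filter fun e => θ ≤ b e, gP e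
  massM : ∀ v, μM v = ∑ e ∈ N.inE v ∩ U, gM e * a e
  massP : ∀ v, μP v = ∑ e ∈ N.outE v ∩ U, gP e * b e
  le_massM : ∀ e ∈ U, a e ≤ μM (N.head e)
  le_massP : ∀ e ∈ U, b e ≤ μP (N.tail e)

namespace IsCover

variable {N : DirPolyNet V E} {U : Finset E} {a b gM gP : E → ℝ} {μM μP : V → ℝ}

theorem massM_nonneg (h : N.IsCover U a b gM gP μM μP) (v : V) : 0 ≤ μM v := by
  rw [h.massM]
  exact Finset.sum_nonneg fun e _ => mul_nonneg (h.gM_nonneg e) (h.a_nonneg e)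

theorem massP_nonneg (h : N.IsCover U a b gM gP μM μP) (v : V) : 0 ≤ μP v := by
  rw [h.massP]
  exact Finset.sum_nonneg fun e _ => mul_nonneg (h.gP_nonneg e) (h.b_nonneg e)

/-- The edges with a half longer than `1 / 6` can be cut at cost six times the total mass. -/
theorem splitCost_long_le (h : N.IsCover U a b gM gP μM μP) :
    N.splitCost (U.filter fun e => 1 / 6 ≤ a e) (U.filter fun e => 1 / 6 ≤ b e) ≤
      6 * ∑ v, (μM v + μP v) := by
  unfold splitCost
  rw [Finset.mul_sum]
  refine Finset.sum_le_sum fun v _ => ?_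
  have key : ∀ (W : Finset E) (g c : E → ℝ), (∀ e, 0 ≤ g e) → (∀ e, 0 ≤ c e) →
      ∑ e ∈ W.filter (fun e => 1 / 6 ≤ c e), g e ≤ 6 * ∑ e ∈ W, g e * c e := by
    intro W g c hg hc
    rw [Finset.sum_filter, Finset.mul_sum]
    refine Finset.sum_le_sum fun e _ => ?_
    split_ifs with h6
    · nlinarith [hg e]
    · have := mul_nonneg (hg e) (hc e)
      linarith
  have hf : ∀ (A : Finset E) (c : E → ℝ), A ∩ U.filter (fun e => 1 / 6 ≤ c e) =
      (A ∩ U).filter fun e => 1 / 6 ≤ c e := fun A c => by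
    ext e
    simp [and_assoc]
  rw [hf, hf, h.levelM, h.levelP, mul_add, h.massM, h.massP]
  exact add_le_add (key _ _ _ h.gM_nonneg h.a_nonneg) (key _ _ _ h.gP_nonneg h.b_nonneg)

/-- Some level cut in `[1/3, 2/3]` costs at most three times the mass of the live vertices `L`. -/
theorem exists_level_cut (h : N.IsCover U a b gM gP μM μP) {G : Finset E} (hG : G ⊆ U)
    (L : Finset V) (d : V → ℝ) :
    ∃ r : ℝ, 1 / 3 ≤ r ∧ r ≤ 2 / 3 ∧
      N.splitCost
        (G.filter fun e => N.head e ∈ L ∧ d (N.head e) - a e ≤ r ∧ r ≤ d (N.head e))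
        (G.filter fun e => N.tail e ∈ L ∧ d (N.tail e) ≤ r ∧ r ≤ d (N.tail e) + b e) ≤
      3 * ∑ v ∈ L, (μM v + μP v) := by
  let wM : E → ℝ := fun e => if e ∈ U ∧ N.head e ∈ L then gM e else 0
  let wP : E → ℝ := fun e => if e ∈ U ∧ N.tail e ∈ L then gP e else 0
  have hwM : ∀ e, 0 ≤ wM e := fun e => by
    simp only [wM]; split_ifs
    exacts [h.gM_nonneg e, le_rfl]
  have hwP : ∀ e, 0 ≤ wP e := fun e => by
    simp only [wP]; split_ifs
    exacts [h.gP_nonneg e, le_rfl]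
  obtain ⟨r, hr1, hr2, hr⟩ := exists_level (I := E ⊕ E) (Sum.elim wM wP)
    (Sum.elim (fun e => d (N.head e) - a e) (fun e => d (N.tail e))) (Sum.elim a b)
    (by rintro (e | e); exacts [hwM e, hwP e])
    (by rintro (e | e); exacts [h.a_nonneg e, h.b_nonneg e])
  simp only [Fintype.sum_sum_type, Sum.elim_inl, Sum.elim_inr, sub_add_cancel] at hr
  refine ⟨r, hr1, hr2, ?_⟩
  have hM : ∀ v, N.rhoM v (N.inE v ∩
      G.filter fun e => N.head e ∈ L ∧ d (N.head e) - a e ≤ r ∧ r ≤ d (N.head e)) ≤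
      ∑ e ∈ N.inE v ∩ U, wM e * (if d (N.head e) - a e ≤ r ∧ r ≤ d (N.head e) then 1 else 0) := by
    intro v
    by_cases hv : v ∈ L ∧ r ≤ d v
    · refine (N.mono_of_subset_inE
        (B := (N.inE v ∩ U).filter fun e => d v - r ≤ a e) (fun e he => ?_)
        ((Finset.filter_subset _ _).trans Finset.inter_subset_left)).trans ?_
      · simp only [inE, Finset.mem_inter, Finset.mem_filter, Finset.mem_univ, true_and] at he ⊢
        obtain ⟨rfl, h1, -, h2, -⟩ := he
        exact ⟨⟨rfl, hG h1⟩, by linarith⟩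
      · rw [h.levelM, Finset.sum_filter]
        refine Finset.sum_le_sum fun e he => ?_
        simp only [inE, Finset.mem_inter, Finset.mem_filter, Finset.mem_univ, true_and] at he
        obtain ⟨rfl, he⟩ := he
        split_ifs with h1 h2
        · simp [wM, he, hv.1]
        · exact absurd ⟨by linarith, hv.2⟩ h2
        · simpa using hwM e
        · simp
    · have h0 : (N.inE v ∩
          G.filter fun e => N.head e ∈ L ∧ d (N.head e) - a e ≤ r ∧ r ≤ d (N.head e)) = ∅ := by
        ext e
        simp only [inE, Finset.mem_inter, Finset.mem_filter, Finset.mem_univ, true_and,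
          Finset.notMem_empty, iff_false]
        rintro ⟨rfl, -, h1, -, h2⟩
        exact hv ⟨h1, h2⟩
      rw [h0, N.rhoM_empty]
      exact Finset.sum_nonneg fun e _ => mul_nonneg (hwM e) (by positivity)
  have hP : ∀ v, N.rhoP v (N.outE v ∩
      G.filter fun e => N.tail e ∈ L ∧ d (N.tail e) ≤ r ∧ r ≤ d (N.tail e) + b e) ≤
      ∑ e ∈ N.outE v ∩ U, wP e * (if d (N.tail e) ≤ r ∧ r ≤ d (N.tail e) + b e then 1 else 0) := by
    intro v
    by_cases hv : v ∈ L ∧ d v ≤ r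
    · refine (N.mono_of_subset_outE
        (B := (N.outE v ∩ U).filter fun e => r - d v ≤ b e) (fun e he => ?_)
        ((Finset.filter_subset _ _).trans Finset.inter_subset_left)).trans ?_
      · simp only [outE, Finset.mem_inter, Finset.mem_filter, Finset.mem_univ, true_and] at he ⊢
        obtain ⟨rfl, h1, -, -, h2⟩ := he
        exact ⟨⟨rfl, hG h1⟩, by linarith⟩
      · rw [h.levelP, Finset.sum_filter]
        refine Finset.sum_le_sum fun e he => ?_
        simp only [outE, Finset.mem_inter, Finset.mem_filter, Finset.mem_univ, true_and] at he
        obtain ⟨rfl, he⟩ := he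
        split_ifs with h1 h2
        · simp [wP, he, hv.1]
        · exact absurd ⟨hv.2, by linarith⟩ h2
        · simpa using hwP e
        · simp
    · have h0 : (N.outE v ∩
          G.filter fun e => N.tail e ∈ L ∧ d (N.tail e) ≤ r ∧ r ≤ d (N.tail e) + b e) = ∅ := by
        ext e
        simp only [outE, Finset.mem_inter, Finset.mem_filter, Finset.mem_univ, true_and,
          Finset.notMem_empty, iff_false]
        rintro ⟨rfl, -, h1, h2, -⟩
        exact hv ⟨h1, h2⟩
      rw [h0, N.rhoP_empty]
      exact Finset.sum_nonneg fun e _ => mul_nonneg (hwP e) (by positivity)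
  have hU : ∀ φ : E → ℝ, (∀ e, 0 ≤ φ e) → ∑ e ∈ U, φ e ≤ ∑ e, φ e := fun φ hφ =>
    Finset.sum_le_sum_of_subset_of_nonneg (Finset.subset_univ _) fun e _ _ => hφ e
  have htotM : ∑ e, wM e * a e = ∑ v ∈ L, μM v := by
    have h1 : ∑ e, wM e * a e = ∑ e ∈ U, wM e * a e := by
      refine (Finset.sum_subset (Finset.subset_univ _) fun e _ he => ?_).symm
      simp [wM, he]
    rw [h1, ← N.sum_inE U, ← Finset.sum_subset (Finset.subset_univ L)]
    · refine Finset.sum_congr rfl fun v hv => ?_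
      rw [h.massM]
      refine Finset.sum_congr rfl fun e he => ?_
      simp only [inE, Finset.mem_inter, Finset.mem_filter, Finset.mem_univ, true_and] at he
      obtain ⟨rfl, he⟩ := he
      simp [wM, he, hv]
    · intro v _ hv
      refine Finset.sum_eq_zero fun e he => ?_
      simp only [inE, Finset.mem_inter, Finset.mem_filter, Finset.mem_univ, true_and] at he
      obtain ⟨rfl, he⟩ := he
      simp [wM, hv]
  have htotP : ∑ e, wP e * b e = ∑ v ∈ L, μP v := by
    have h1 : ∑ e, wP e * b e = ∑ e ∈ U, wP e * b e := by
      refine (Finset.sum_subset (Finset.subset_univ _) fun e _ he => ?_).symm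
      simp [wP, he]
    rw [h1, ← N.sum_outE U, ← Finset.sum_subset (Finset.subset_univ L)]
    · refine Finset.sum_congr rfl fun v hv => ?_
      rw [h.massP]
      refine Finset.sum_congr rfl fun e he => ?_
      simp only [outE, Finset.mem_inter, Finset.mem_filter, Finset.mem_univ, true_and] at he
      obtain ⟨rfl, he⟩ := he
      simp [wP, he, hv]
    · intro v _ hv
      refine Finset.sum_eq_zero fun e he => ?_
      simp only [outE, Finset.mem_inter, Finset.mem_filter, Finset.mem_univ, true_and] at he
      obtain ⟨rfl, he⟩ := he
      simp [wP, hv]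
  rw [htotM, htotP] at hr
  rw [Finset.sum_add_distrib (s := L)]
  refine le_trans ?_ hr
  refine (Finset.sum_le_sum fun v _ => add_le_add (hM v) (hP v)).trans ?_
  rw [Finset.sum_add_distrib, N.sum_inE, N.sum_outE]
  exact add_le_add (hU _ fun e => mul_nonneg (hwM e) (by positivity))
    (hU _ fun e => mul_nonneg (hwP e) (by positivity))

/-- A path that starts at level at most `r` and ends at level at least one has mass at least
`1 / 6` on its vertices beyond level `r`. -/
theorem mass_beyond (h : N.IsCover U a b gM gP μM μP) {v t : V} {p : List E}
    (hp : N.IsPath v t p) (hpU : ∀ e ∈ p, e ∈ U) (ha : ∀ e ∈ p, a e ≤ 1 / 6)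
    (hb : ∀ e ∈ p, b e ≤ 1 / 6) {d : V → ℝ} {r : ℝ} (hr : r ≤ 2 / 3)
    (hd : ∀ e ∈ p, d (N.head e) ≤ d (N.tail e) + (a e + b e)) (hv : d v ≤ r) (ht : 1 ≤ d t)
    {H : Finset V} (hH : ∀ e ∈ p, (r < d (N.head e) → N.head e ∈ H) ∧
      (r < d (N.tail e) → N.tail e ∈ H)) :
    1 / 6 ≤ ∑ u ∈ H, (μM u + μP u) := by
  let f : V → ℝ := fun x => max (d x) (r + 1 / 6)
  have hα : ∀ x, 0 ≤ if x ∈ H then μM x else 0 := fun x => by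
    split_ifs
    exacts [h.massM_nonneg x, le_rfl]
  have hγ : ∀ x, 0 ≤ if x ∈ H then μP x else 0 := fun x => by
    split_ifs
    exacts [h.massP_nonneg x, le_rfl]
  have h1 := hp.sum_le (k := fun e => f (N.head e) - f (N.tail e)) hα hγ fun e he => by
    have hA := h.a_nonneg e
    have hB := h.b_nonneg e
    have h1 := h.le_massM e (hpU e he)
    have h2 := h.le_massP e (hpU e he)
    have h3 := ha e he
    have h4 := hb e he
    have h5 := hd e he
    simp only [f]
    rw [sub_le_iff_le_add]
    rcases le_or_gt (d (N.head e)) r with h6 | h6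
    · have := hα (N.head e)
      have := hγ (N.tail e)
      have := le_max_right (d (N.tail e)) (r + 1 / 6)
      refine max_le ?_ ?_ <;> linarith
    · rw [if_pos ((hH e he).1 h6)]
      rcases le_or_gt (d (N.tail e)) r with h7 | h7
      · have := hγ (N.tail e)
        have := le_max_right (d (N.tail e)) (r + 1 / 6)
        refine max_le ?_ ?_ <;> linarith
      · rw [if_pos ((hH e he).2 h7)]
        have := le_max_right (d (N.tail e)) (r + 1 / 6)
        have := le_max_left (d (N.tail e)) (r + 1 / 6)
        refine max_le ?_ ?_ <;> linarith
  rw [hp.1.telescope f] at h1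
  have h2 : f v = r + 1 / 6 := max_eq_right (by linarith)
  have h3 : 1 ≤ f t := ht.trans (le_max_left _ _)
  have h4 : ∑ u, ((if u ∈ H then μM u else 0) + if u ∈ H then μP u else 0) =
      ∑ u ∈ H, (μM u + μP u) := by
    rw [Finset.sum_add_distrib, Finset.sum_add_distrib, Finset.sum_ite_mem, Finset.sum_ite_mem,
      Finset.univ_inter]
  linarith

/-- A path that starts at level at most zero and ends beyond level `r` has mass at least `1 / 6`
on its vertices of level at most `r`. -/
theorem mass_before (h : N.IsCover U a b gM gP μM μP) {s v : V} {p : List E}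
    (hp : N.IsPath s v p) (hpU : ∀ e ∈ p, e ∈ U) (ha : ∀ e ∈ p, a e ≤ 1 / 6)
    (hb : ∀ e ∈ p, b e ≤ 1 / 6) {d : V → ℝ} {r : ℝ} (hr : 1 / 3 ≤ r)
    (hd : ∀ e ∈ p, d (N.head e) ≤ d (N.tail e) + (a e + b e)) (hs : d s ≤ 0) (hv : r < d v)
    {H : Finset V} (hH : ∀ e ∈ p, (d (N.head e) ≤ r → N.head e ∈ H) ∧
      (d (N.tail e) ≤ r → N.tail e ∈ H)) :
    1 / 6 ≤ ∑ u ∈ H, (μM u + μP u) := by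
  let f : V → ℝ := fun x => min (d x) (r - 1 / 6)
  have hα : ∀ x, 0 ≤ if x ∈ H then μM x else 0 := fun x => by
    split_ifs
    exacts [h.massM_nonneg x, le_rfl]
  have hγ : ∀ x, 0 ≤ if x ∈ H then μP x else 0 := fun x => by
    split_ifs
    exacts [h.massP_nonneg x, le_rfl]
  have h1 := hp.sum_le (k := fun e => f (N.head e) - f (N.tail e)) hα hγ fun e he => by
    have hA := h.a_nonneg e
    have hB := h.b_nonneg e
    have h1 := h.le_massM e (hpU e he)
    have h2 := h.le_massP e (hpU e he)
    have h3 := ha e he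
    have h4 := hb e he
    have h5 := hd e he
    have h8 := min_le_left (d (N.head e)) (r - 1 / 6)
    have h9 := min_le_right (d (N.head e)) (r - 1 / 6)
    simp only [f]
    rw [sub_le_comm]
    rcases le_or_gt (d (N.tail e)) r with h6 | h6
    · rw [if_pos ((hH e he).2 h6)]
      rcases le_or_gt (d (N.head e)) r with h7 | h7
      · rw [if_pos ((hH e he).1 h7)]
        refine le_min ?_ ?_ <;> linarith
      · have := hα (N.head e)
        refine le_min ?_ ?_ <;> linarith
    · have := hα (N.head e)
      have := hγ (N.tail e)
      refine le_min ?_ ?_ <;> linarith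
  rw [hp.1.telescope f] at h1
  have h2 : f v = r - 1 / 6 := min_eq_right (by linarith)
  have h3 : f s ≤ 0 := (min_le_left _ _).trans hs
  have h4 : ∑ u, ((if u ∈ H then μM u else 0) + if u ∈ H then μP u else 0) =
      ∑ u ∈ H, (μM u + μP u) := by
    rw [Finset.sum_add_distrib, Finset.sum_add_distrib, Finset.sum_ite_mem, Finset.sum_ite_mem,
      Finset.univ_inter]
  linarith

end IsCover

/-- The total mass of the ordered pairs of vertices that are connected in `G`. -/
noncomputable def pairMass (N : DirPolyNet V E) (μ : V → ℝ) (G : Finset E) : ℝ :=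
  ∑ v, ∑ u, if N.Conn G v u then μ v * μ u else 0

theorem pairMass_nonneg (N : DirPolyNet V E) {μ : V → ℝ} (hμ : ∀ v, 0 ≤ μ v) (G : Finset E) :
    0 ≤ N.pairMass μ G := by
  refine Finset.sum_nonneg fun v _ => Finset.sum_nonneg fun u _ => ?_
  split_ifs
  exacts [mul_nonneg (hμ v) (hμ u), le_rfl]

theorem pairMass_le (N : DirPolyNet V E) {μ : V → ℝ} (hμ : ∀ v, 0 ≤ μ v) (G : Finset E) :
    N.pairMass μ G ≤ (∑ v, μ v) ^ 2 := by
  rw [sq, Finset.sum_mul_sum]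
  refine Finset.sum_le_sum fun v _ => Finset.sum_le_sum fun u _ => ?_
  split_ifs
  exacts [le_rfl, mul_nonneg (hμ v) (hμ u)]

namespace IsCover

variable {N : DirPolyNet V E} {U : Finset E} {a b gM gP : E → ℝ} {μM μP : V → ℝ}

/-- A connected pair can be separated at a cost proportional to the drop in pair mass. -/
theorem exists_separating (h : N.IsCover U a b gM gP μM μP) {G : Finset E} (hG : G ⊆ U)
    (ha : ∀ e ∈ G, a e ≤ 1 / 6) (hb : ∀ e ∈ G, b e ≤ 1 / 6) {s t : V} (hst : N.Conn G s t)
    (hlong : ∀ p, N.IsPath s t p → (∀ e ∈ p, e ∈ G) → 1 ≤ (p.map fun e => a e + b e).sum) :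
    ∃ X Y : Finset E, ¬ N.Conn (G \ (X ∪ Y)) s t ∧
      N.splitCost X Y ≤ 36 * (N.pairMass (fun v => μM v + μP v) G -
        N.pairMass (fun v => μM v + μP v) (G \ (X ∪ Y))) := by
  obtain ⟨d, hds, hdt, hd⟩ := N.exists_dist G (fun e => add_nonneg (h.a_nonneg e) (h.b_nonneg e))
    hst hlong
  let L : Finset V := Finset.univ.filter fun v => N.Conn G s v ∧ N.Conn G v t
  have hL : ∀ v, v ∈ L ↔ N.Conn G s v ∧ N.Conn G v t := fun v => by simp [L]
  obtain ⟨r, hr1, hr2, hcost⟩ := h.exists_level_cut hG L d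
  set X := G.filter fun e => N.head e ∈ L ∧ d (N.head e) - a e ≤ r ∧ r ≤ d (N.head e) with hX
  set Y := G.filter fun e => N.tail e ∈ L ∧ d (N.tail e) ≤ r ∧ r ≤ d (N.tail e) + b e with hY
  set μ : V → ℝ := fun v => μM v + μP v with hμdef
  have hμ : ∀ v, 0 ≤ μ v := fun v => add_nonneg (h.massM_nonneg v) (h.massP_nonneg v)
  have hstay : ∀ (p : List E) (u w : V), N.IsWalk u w p → (∀ e ∈ p, e ∈ G \ (X ∪ Y)) →
      N.Conn G s u → d u ≤ r → N.Conn G w t → d w ≤ r := by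
    intro p
    induction p with
    | nil =>
      intro u w hp _ _ hu _
      obtain rfl : u = w := hp
      exact hu
    | cons e p ih =>
      rintro u w ⟨rfl, hp⟩ hpG hsu hu hw
      have he := Finset.mem_sdiff.1 (hpG e List.mem_cons_self)
      have hpG' : ∀ f ∈ p, f ∈ G \ (X ∪ Y) := fun f hf => hpG f (List.mem_cons_of_mem _ hf)
      have hsh : N.Conn G s (N.head e) := hsu.trans (Conn.edge he.1)
      have hht : N.Conn G (N.head e) t :=
        Conn.trans ⟨p, hp, fun f hf => (Finset.mem_sdiff.1 (hpG' f hf)).1⟩ hw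
      refine ih _ _ hp hpG' hsh ?_ hw
      by_contra! hlt
      refine he.2 (Finset.mem_union.2 ?_)
      have h1 := hd e he.1 hsu
      rcases le_total r (d (N.tail e) + b e) with h2 | h2
      · exact Or.inr (Finset.mem_filter.2
          ⟨he.1, (hL _).2 ⟨hsu, (Conn.edge he.1).trans hht⟩, hu, h2⟩)
      · exact Or.inl (Finset.mem_filter.2 ⟨he.1, (hL _).2 ⟨hsh, hht⟩, by linarith, hlt.le⟩)
  have hsub : G \ (X ∪ Y) ⊆ G := Finset.sdiff_subset
  refine ⟨X, Y, ?_, ?_⟩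
  · rintro ⟨p, hp, hpG⟩
    have := hstay p s t hp hpG (Conn.refl N G s) (by linarith) (Conn.refl N G t)
    linarith
  · let Q : V → V → ℝ := fun v u =>
      if (v ∈ L ∧ d v ≤ r) ∧ (u ∈ L ∧ ¬ d u ≤ r) ∧ N.Conn G v u then μ v * μ u else 0
    have hQ0 : ∀ v u, 0 ≤ Q v u := fun v u => by
      simp only [Q]; split_ifs
      exacts [mul_nonneg (hμ v) (hμ u), le_rfl]
    have hdrop : N.pairMass μ (G \ (X ∪ Y)) + ∑ v, ∑ u, Q v u ≤ N.pairMass μ G := by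
      unfold pairMass
      rw [← Finset.sum_add_distrib]
      refine Finset.sum_le_sum fun v _ => ?_
      rw [← Finset.sum_add_distrib]
      refine Finset.sum_le_sum fun u _ => ?_
      by_cases h1 : N.Conn (G \ (X ∪ Y)) v u
      · have h2 : Q v u = 0 := by
          refine if_neg ?_
          rintro ⟨⟨hv, hv'⟩, ⟨hu, hu'⟩, -⟩
          obtain ⟨p, hp, hpG⟩ := h1
          exact hu' (hstay p v u hp hpG ((hL v).1 hv).1 hv' ((hL u).1 hu).2)
        rw [h2, if_pos h1, if_pos (h1.mono hsub), add_zero]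
      · rw [if_neg h1, zero_add]
        by_cases h2 : N.Conn G v u
        · rw [if_pos h2]
          simp only [Q]; split_ifs
          exacts [le_rfl, mul_nonneg (hμ v) (hμ u)]
        · rw [if_neg h2]
          simp [Q, h2]
    have hfwd : 1 / 6 * ∑ v ∈ L.filter (fun v => d v ≤ r), μ v ≤ ∑ v, ∑ u, Q v u := by
      rw [Finset.mul_sum]
      refine le_trans ?_ (Finset.sum_le_sum_of_subset_of_nonneg
        (Finset.subset_univ (L.filter fun v => d v ≤ r))
        fun v _ _ => Finset.sum_nonneg fun u _ => hQ0 v u)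
      refine Finset.sum_le_sum fun v hv => ?_
      obtain ⟨hvL, hvr⟩ := Finset.mem_filter.1 hv
      obtain ⟨hsv, hvt⟩ := (hL v).1 hvL
      have h1 : ∑ u, Q v u =
          μ v * ∑ u ∈ Finset.univ.filter (fun u => (u ∈ L ∧ ¬ d u ≤ r) ∧ N.Conn G v u), μ u := by
        rw [Finset.mul_sum, Finset.sum_filter]
        refine Finset.sum_congr rfl fun u _ => ?_
        simp [Q, hvL, hvr]
      rw [h1, mul_comm]
      refine mul_le_mul_of_nonneg_left ?_ (hμ v)
      obtain ⟨p, hp, hpG⟩ := hvt.exists_path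
      have hon : ∀ e ∈ p, N.Conn G v (N.tail e) ∧ N.Conn G (N.head e) t :=
        hp.1.conn_of_mem hpG
      refine h.mass_beyond hp (fun e he => hG (hpG e he)) (fun e he => ha e (hpG e he))
        (fun e he => hb e (hpG e he)) hr2 (fun e he => hd e (hpG e he) (hsv.trans (hon e he).1))
        hvr hdt fun e he => ⟨fun h2 => ?_, fun h2 => ?_⟩
      · have h3 := (hon e he).1.trans (Conn.edge (hpG e he))
        simpa [hL, h2] using ⟨⟨hsv.trans h3, (hon e he).2⟩, h3⟩
      · have h3 := (Conn.edge (hpG e he)).trans (hon e he).2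
        simpa [hL, h2] using ⟨⟨hsv.trans (hon e he).1, h3⟩, (hon e he).1⟩
    have hbwd : 1 / 6 * ∑ u ∈ L.filter (fun u => ¬ d u ≤ r), μ u ≤ ∑ v, ∑ u, Q v u := by
      rw [Finset.mul_sum, Finset.sum_comm]
      refine le_trans ?_ (Finset.sum_le_sum_of_subset_of_nonneg
        (Finset.subset_univ (L.filter fun u => ¬ d u ≤ r))
        fun u _ _ => Finset.sum_nonneg fun v _ => hQ0 v u)
      refine Finset.sum_le_sum fun u hu => ?_
      obtain ⟨huL, hur⟩ := Finset.mem_filter.1 hu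
      obtain ⟨hsu, hut⟩ := (hL u).1 huL
      have h1 : ∑ v, Q v u =
          μ u * ∑ v ∈ Finset.univ.filter (fun v => (v ∈ L ∧ d v ≤ r) ∧ N.Conn G v u), μ v := by
        rw [Finset.mul_sum, Finset.sum_filter]
        refine Finset.sum_congr rfl fun v _ => ?_
        simp only [Q, huL, hur, not_false_eq_true, and_self, true_and, mul_comm]
      rw [h1, mul_comm]
      refine mul_le_mul_of_nonneg_left ?_ (hμ u)
      obtain ⟨p, hp, hpG⟩ := hsu.exists_path
      have hon : ∀ e ∈ p, N.Conn G s (N.tail e) ∧ N.Conn G (N.head e) u :=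
        hp.1.conn_of_mem hpG
      refine h.mass_before hp (fun e he => hG (hpG e he)) (fun e he => ha e (hpG e he))
        (fun e he => hb e (hpG e he)) hr1 (fun e he => hd e (hpG e he) (hon e he).1)
        hds (not_le.1 hur) fun e he => ⟨fun h2 => ?_, fun h2 => ?_⟩
      · have h3 := (hon e he).1.trans (Conn.edge (hpG e he))
        simpa [hL, h2] using ⟨⟨h3, (hon e he).2.trans hut⟩, (hon e he).2⟩
      · have h3 := (Conn.edge (hpG e he)).trans (hon e he).2
        simpa [hL, h2] using ⟨⟨(hon e he).1, h3.trans hut⟩, h3⟩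
    have hsplit := Finset.sum_filter_add_sum_filter_not L (fun v => d v ≤ r) μ
    linarith

/-- All connected pairs can be separated at cost at most `36` times the pair mass. -/
theorem exists_separating_all (h : N.IsCover U a b gM gP μM μP) {ι : Type} (s t : ι → V)
    (G : Finset E) : G ⊆ U → (∀ e ∈ G, a e ≤ 1 / 6) → (∀ e ∈ G, b e ≤ 1 / 6) →
    (∀ i p, N.IsPath (s i) (t i) p → (∀ e ∈ p, e ∈ G) → 1 ≤ (p.map fun e => a e + b e).sum) →
    ∃ X Y : Finset E, (∀ i, ¬ N.Conn (G \ (X ∪ Y)) (s i) (t i)) ∧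
      N.splitCost X Y ≤ 36 * N.pairMass (fun v => μM v + μP v) G := by
  induction G using Finset.strongInduction with
  | H G ih =>
    intro hG ha hb hlong
    by_cases hc : ∃ i, N.Conn G (s i) (t i)
    · obtain ⟨i, hi⟩ := hc
      obtain ⟨X, Y, hsep, hcost⟩ := h.exists_separating hG ha hb hi (hlong i)
      have hsub : G \ (X ∪ Y) ⊆ G := Finset.sdiff_subset
      have hss : G \ (X ∪ Y) ⊂ G :=
        hsub.ssubset_of_ne fun heq => hsep (by rwa [heq])
      obtain ⟨X', Y', hsep', hcost'⟩ := ih _ hss (hsub.trans hG) (fun e he => ha e (hsub he))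
        (fun e he => hb e (hsub he))
        (fun j p hp hpG => hlong j p hp fun e he => hsub (hpG e he))
      refine ⟨X ∪ X', Y ∪ Y', fun j => ?_, ?_⟩
      · rw [sdiff_union_union_union]
        exact hsep' j
      · have := N.splitCost_union_le X Y X' Y'
        linarith
    · push Not at hc
      refine ⟨∅, ∅, by simpa using hc, ?_⟩
      have h1 : N.splitCost ∅ ∅ = 0 := by simp [splitCost, N.rhoM_empty, N.rhoP_empty]
      have h2 := N.pairMass_nonneg
        (fun v => add_nonneg (h.massM_nonneg v) (h.massP_nonneg v)) G
      linarith

theorem exists_split_multicut (h : N.IsCover U a b gM gP μM μP) {ι : Type} (s t : ι → V)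
    (hlong : ∀ i p, N.IsPath (s i) (t i) p → (∀ e ∈ p, e ∈ U) →
      1 ≤ (p.map fun e => a e + b e).sum) :
    ∃ X Y : Finset E, (∀ i, ¬ N.Conn (U \ (X ∪ Y)) (s i) (t i)) ∧
      N.splitCost X Y ≤ 6 * ∑ v, (μM v + μP v) + 36 * (∑ v, (μM v + μP v)) ^ 2 := by
  set X₀ := U.filter fun e => 1 / 6 ≤ a e with hX₀
  set Y₀ := U.filter fun e => 1 / 6 ≤ b e with hY₀
  have hsub : U \ (X₀ ∪ Y₀) ⊆ U := Finset.sdiff_subset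
  have hshort : ∀ e ∈ U \ (X₀ ∪ Y₀), a e ≤ 1 / 6 ∧ b e ≤ 1 / 6 := by
    intro e he
    simp only [hX₀, hY₀, Finset.mem_sdiff, Finset.mem_union, Finset.mem_filter, not_or, not_and,
      not_le] at he
    exact ⟨(he.2.1 he.1).le, (he.2.2 he.1).le⟩
  obtain ⟨X, Y, hsep, hcost⟩ := h.exists_separating_all s t (U \ (X₀ ∪ Y₀)) hsub
    (fun e he => (hshort e he).1) (fun e he => (hshort e he).2)
    (fun i p hp hpG => hlong i p hp fun e he => hsub (hpG e he))
  refine ⟨X₀ ∪ X, Y₀ ∪ Y, fun i => ?_, ?_⟩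
  · rw [sdiff_union_union_union]
    exact hsep i
  · have h1 := N.splitCost_union_le X₀ Y₀ X Y
    have h2 := h.splitCost_long_le
    have h3 := N.pairMass_le (fun v => add_nonneg (h.massM_nonneg v) (h.massP_nonneg v))
      (U \ (X₀ ∪ Y₀))
    linarith

end IsCover

/-- The total weight of the sets containing the edge `e` in the family of its endpoint `κ e`. -/
noncomputable def load (κ : E → V) (y : V → Finset E → ℝ) (e : E) : ℝ :=
  ∑ S, if e ∈ S then y (κ e) S else 0

theorem load_nonneg {V E : Type} [Fintype E] [DecidableEq E] (κ : E → V)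
    {y : V → Finset E → ℝ} (hy : ∀ v S, 0 ≤ y v S) (e : E) :
    0 ≤ load κ y e := by
  refine Finset.sum_nonneg fun S _ => ?_
  split_ifs
  exacts [hy _ _, le_rfl]

/-- A greedy vector for the loads at a single vertex with ground set `W`: it computes the cost of
the superlevel sets, and the mass it yields is at least every load and at most the weighted cost. -/
theorem exists_mass (ρ : Finset E → ℝ) (W : Finset E) (a : E → ℝ) (y : Finset E → ℝ)
    (hy : ∀ S, 0 ≤ y S) (ha : ∀ e ∈ W, a e = ∑ S, if e ∈ S then y S else 0)
    (h0 : ρ ∅ = 0) (hmono : ∀ A B, A ⊆ B → B ⊆ W → ρ A ≤ ρ B)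
    (hsub : ∀ A B, A ⊆ W → B ⊆ W → ρ (A ∪ B) + ρ (A ∩ B) ≤ ρ A + ρ B)
    (hone : ∀ e ∈ W, 1 ≤ ρ {e}) :
    ∃ g : E → ℝ, (∀ e, 0 ≤ g e) ∧
      (∀ θ : ℝ, ρ (W.filter fun e => θ ≤ a e) = ∑ e ∈ W.filter (fun e => θ ≤ a e), g e) ∧
      (∀ e ∈ W, a e ≤ ∑ f ∈ W, g f * a f) ∧
      ∑ e ∈ W, g e * a e ≤ ∑ S, y S * ρ (S ∩ W) := by
  obtain ⟨g, hg, hS, hθ⟩ := exists_greedy ρ a W h0 hmono hsub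
  have ha0 : ∀ e ∈ W, 0 ≤ a e := fun e he => by
    rw [ha e he]
    refine Finset.sum_nonneg fun S _ => ?_
    split_ifs
    exacts [hy _, le_rfl]
  refine ⟨g, hg, fun θ => (hθ θ).symm, fun e he => ?_, ?_⟩
  · have h1 : ρ {e} ≤ ρ (W.filter fun f => a e ≤ a f) :=
      hmono _ _ (by simpa using he) (Finset.filter_subset _ _)
    rw [← hθ] at h1
    calc a e ≤ (∑ f ∈ W.filter (fun f => a e ≤ a f), g f) * a e :=
          le_mul_of_one_le_left (ha0 e he) ((hone e he).trans h1)
      _ ≤ ∑ f ∈ W.filter (fun f => a e ≤ a f), g f * a f := by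
          rw [Finset.sum_mul]
          exact Finset.sum_le_sum fun f hf =>
            mul_le_mul_of_nonneg_left (Finset.mem_filter.1 hf).2 (hg f)
      _ ≤ ∑ f ∈ W, g f * a f :=
          Finset.sum_le_sum_of_subset_of_nonneg (Finset.filter_subset _ _)
            fun f hf _ => mul_nonneg (hg f) (ha0 f hf)
  · have h1 : ∑ e ∈ W, g e * a e = ∑ S, y S * ∑ e ∈ S ∩ W, g e := by
      have h2 : ∀ e ∈ W, g e * a e = ∑ S, if e ∈ S then y S * g e else 0 := fun e he => by
        rw [ha e he, Finset.mul_sum]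
        refine Finset.sum_congr rfl fun S _ => ?_
        rw [mul_ite, mul_zero, mul_comm]
      rw [Finset.sum_congr rfl h2, Finset.sum_comm]
      refine Finset.sum_congr rfl fun S _ => ?_
      rw [Finset.mul_sum, Finset.inter_comm, ← Finset.sum_ite_mem]
    rw [h1]
    exact Finset.sum_le_sum fun S _ =>
      mul_le_mul_of_nonneg_left (hS _ Finset.inter_subset_right) (hy S)

/-- Every weighting of the vertex sets induces a cover whose mass is at most its cost. -/
theorem exists_isCover (N : DirPolyNet V E) (U : Finset E) {yM yP : V → Finset E → ℝ}
    (hyM : ∀ v S, 0 ≤ yM v S) (hyP : ∀ v S, 0 ≤ yP v S)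
    (hM : ∀ e ∈ U, 1 ≤ N.rhoM (N.head e) {e}) (hP : ∀ e ∈ U, 1 ≤ N.rhoP (N.tail e) {e}) :
    ∃ (gM gP : E → ℝ) (μM μP : V → ℝ),
      N.IsCover U (load N.head yM) (load N.tail yP) gM gP μM μP ∧
      ∑ v, (μM v + μP v) ≤ ∑ v, ((∑ S, yM v S * N.rhoM v (S ∩ (N.inE v ∩ U))) +
        ∑ S, yP v S * N.rhoP v (S ∩ (N.outE v ∩ U))) := by
  have hin : ∀ {v e}, e ∈ N.inE v ∩ U → N.head e = v ∧ e ∈ U := fun he => by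
    simpa [inE] using he
  have hout : ∀ {v e}, e ∈ N.outE v ∩ U → N.tail e = v ∧ e ∈ U := fun he => by
    simpa [outE] using he
  have h1 := fun v => exists_mass (N.rhoM v) (N.inE v ∩ U) (load N.head yM) (yM v) (hyM v)
    (fun e he => by rw [load, (hin he).1]) (N.rhoM_empty v)
    (fun A B hAB hB => N.rhoM_mono v A B hAB (hB.trans Finset.inter_subset_left))
    (fun A B hA hB => N.rhoM_submod v A B (hA.trans Finset.inter_subset_left)
      (hB.trans Finset.inter_subset_left))
    (fun e he => (hin he).1 ▸ hM e (hin he).2)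
  have h2 := fun v => exists_mass (N.rhoP v) (N.outE v ∩ U) (load N.tail yP) (yP v) (hyP v)
    (fun e he => by rw [load, (hout he).1]) (N.rhoP_empty v)
    (fun A B hAB hB => N.rhoP_mono v A B hAB (hB.trans Finset.inter_subset_left))
    (fun A B hA hB => N.rhoP_submod v A B (hA.trans Finset.inter_subset_left)
      (hB.trans Finset.inter_subset_left))
    (fun e he => (hout he).1 ▸ hP e (hout he).2)
  choose gM hgM hlM hmM hcM using h1
  choose gP hgP hlP hmP hcP using h2
  have hsM : ∀ v (W : Finset E) (c : E → ℝ), W ⊆ N.inE v ∩ U →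
      ∑ e ∈ W, gM (N.head e) e * c e = ∑ e ∈ W, gM v e * c e := fun v W c hW =>
    Finset.sum_congr rfl fun e he => by rw [(hin (hW he)).1]
  have hsP : ∀ v (W : Finset E) (c : E → ℝ), W ⊆ N.outE v ∩ U →
      ∑ e ∈ W, gP (N.tail e) e * c e = ∑ e ∈ W, gP v e * c e := fun v W c hW =>
    Finset.sum_congr rfl fun e he => by rw [(hout (hW he)).1]
  refine ⟨fun e => gM (N.head e) e, fun e => gP (N.tail e) e,
    fun v => ∑ e ∈ N.inE v ∩ U, gM v e * load N.head yM e,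
    fun v => ∑ e ∈ N.outE v ∩ U, gP v e * load N.tail yP e, ?_, ?_⟩
  · refine ⟨load_nonneg _ hyM, load_nonneg _ hyP, fun e => hgM _ e, fun e => hgP _ e,
      fun v θ => ?_, fun v θ => ?_, fun v => (hsM v _ _ subset_rfl).symm,
      fun v => (hsP v _ _ subset_rfl).symm, fun e he => ?_, fun e he => ?_⟩
    · have := hsM v _ (fun _ => 1) (Finset.filter_subset (fun e => θ ≤ load N.head yM e) _)
      simp only [mul_one] at this
      rw [hlM, this]
    · have := hsP v _ (fun _ => 1) (Finset.filter_subset (fun e => θ ≤ load N.tail yP e) _)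
      simp only [mul_one] at this
      rw [hlP, this]
    · exact hmM _ e (by simp [inE, he])
    · exact hmP _ e (by simp [outE, he])
  · exact Finset.sum_le_sum fun v _ => add_le_add (hcM v) (hcP v)

theorem bddAbove_throughput (N : DirPolyNet V E) {ι : Type} [Fintype ι] {s t : ι → V}
    (hst : ∀ i, s i ≠ t i) :
    BddAbove {r : ℝ | ∃ f : ι → List E → ℝ, N.IsFlow s t f ∧ r = ∑ i, rate f i} := by
  refine ⟨∑ v, N.rhoP v (N.outE v), ?_⟩
  rintro _ ⟨f, hf, rfl⟩
  calc ∑ i, rate f i ≤ ∑ i, ∑ e, ∑ᶠ p ∈ {p : List E | e ∈ p}, f i p := by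
        refine Finset.sum_le_sum fun i _ => ?_
        have hsupp : Function.support (f i) ⊆ ((hf.fin i).toFinset : Set (List E)) := by simp
        have h1 : ∀ e, ∑ᶠ p ∈ {p : List E | e ∈ p}, f i p =
            ∑ p ∈ (hf.fin i).toFinset, if e ∈ p then f i p else 0 := fun e => by
          rw [finsum_mem_def, finsum_eq_sum_of_support_subset (s := (hf.fin i).toFinset)]
          · exact Finset.sum_congr rfl fun p _ => by simp [Set.indicator_apply]
          · exact fun p hp => hsupp fun h0 => hp (by simp [Set.indicator_apply, h0])
        rw [rate, finsum_eq_sum_of_support_subset _ hsupp, Finset.sum_congr rfl fun e _ => h1 e,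
          Finset.sum_comm]
        refine Finset.sum_le_sum fun p hp => ?_
        cases p with
        | nil => exact absurd (hf.supp i [] (by simpa using hp)).1 (hst i)
        | cons e p =>
          refine le_trans (by simp) (Finset.single_le_sum
            (f := fun e' => if e' ∈ e :: p then f i (e :: p) else 0)
            (fun e' _ => ?_) (Finset.mem_univ e))
          split_ifs
          exacts [hf.nonneg _ _, le_rfl]
    _ = ∑ v, ∑ e ∈ N.outE v, N.edgeFlow f e := by
        have h1 := N.sum_outE Finset.univ (N.edgeFlow f)
        simp only [Finset.inter_univ] at h1
        rw [h1, Finset.sum_comm]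
        rfl
    _ ≤ ∑ v, N.rhoP v (N.outE v) :=
        Finset.sum_le_sum fun v _ => hf.capP v _ subset_rfl

/-- The simple paths of the instance that use only edges of `U`. -/
abbrev PathIn (N : DirPolyNet V E) {ι : Type} (s t : ι → V) (U : Finset E) : Type :=
  {q : ι × {l : List E // l.Nodup} // N.IsPath (s q.1) (t q.1) q.2.1 ∧ ∀ e ∈ q.2.1, e ∈ U}

namespace PathIn

variable {N : DirPolyNet V E} {ι : Type} {s t : ι → V} {U : Finset E}

/-- The edges of a path. -/
abbrev edges (q : N.PathIn s t U) : List E := q.1.2.1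

/-- The number of edges of `W` on a path. -/
noncomputable def count (W : Finset E) (q : N.PathIn s t U) : ℝ :=
  ∑ e ∈ W, if e ∈ q.edges then 1 else 0

/-- Along a path, the weighted count of its edges is the total load. -/
theorem sum_mul_count (κ : E → V) (y : V → Finset E → ℝ) (W : V → Finset E)
    (hW : ∀ v, ∀ e ∈ W v, κ e = v) (hsum : ∀ φ : E → ℝ, ∑ v, ∑ e ∈ W v ∩ U, φ e = ∑ e ∈ U, φ e)
    (q : N.PathIn s t U) :
    ∑ v, ∑ S, y v S * count (S ∩ (W v ∩ U)) q = (q.edges.map (load κ y)).sum := by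
  have h1 : ∀ v, ∑ S, y v S * count (S ∩ (W v ∩ U)) q =
      ∑ e ∈ W v ∩ U, if e ∈ q.edges then load κ y e else 0 := by
    intro v
    have h2 : ∀ S, y v S * count (S ∩ (W v ∩ U)) q =
        ∑ e ∈ W v ∩ U, if e ∈ S then if e ∈ q.edges then y v S else 0 else 0 := fun S => by
      rw [count, Finset.mul_sum, Finset.inter_comm, ← Finset.sum_ite_mem]
      simp only [mul_ite, mul_one, mul_zero]
    rw [Finset.sum_congr rfl fun S _ => h2 S, Finset.sum_comm]
    refine Finset.sum_congr rfl fun e he => ?_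
    rw [load, hW v e (Finset.mem_inter.1 he).1]
    split_ifs with h3
    · rfl
    · simp only [ite_self, Finset.sum_const_zero]
  rw [Finset.sum_congr rfl fun v _ => h1 v, hsum, ← List.sum_toFinset _ q.1.2.2,
    ← Finset.sum_filter]
  refine Finset.sum_congr ?_ fun _ _ => rfl
  ext e
  simp only [Finset.mem_filter, List.mem_toFinset]
  exact ⟨fun h => h.2, fun h => ⟨q.2.2 e h, h⟩⟩

variable [Fintype ι]

/-- The assignment of flow values to all lists of edges given by values on paths. -/
noncomputable def flow (x : N.PathIn s t U → ℝ) (i : ι) (p : List E) : ℝ :=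
  ∑ q, if q.1.1 = i ∧ q.edges = p then x q else 0

theorem exists_of_flow_ne_zero {x : N.PathIn s t U → ℝ} {i : ι} {p : List E}
    (h : flow x i p ≠ 0) : ∃ q : N.PathIn s t U, q.1.1 = i ∧ q.edges = p := by
  obtain ⟨q, -, hq⟩ := Finset.exists_ne_zero_of_sum_ne_zero h
  exact ⟨q, by_contra fun h' => hq (if_neg h')⟩

theorem support_flow_subset (x : N.PathIn s t U → ℝ) (i : ι) :
    Function.support (flow x i) ⊆
      ((Finset.univ.image fun q : N.PathIn s t U => q.edges : Finset (List E)) : Set (List E)) :=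
  fun p hp => by
    obtain ⟨q, -, hq⟩ := exists_of_flow_ne_zero hp
    exact Finset.mem_coe.2 (Finset.mem_image.2 ⟨q, Finset.mem_univ q, hq⟩)

theorem sum_finsum_flow (x : N.PathIn s t U → ℝ) (A : Set (List E)) :
    ∑ i, ∑ᶠ p ∈ A, flow x i p = ∑ q : N.PathIn s t U, if q.edges ∈ A then x q else 0 := by
  have h1 : ∀ i, ∑ᶠ p ∈ A, flow x i p =
      ∑ p ∈ Finset.univ.image fun q : N.PathIn s t U => q.edges, ∑ q : N.PathIn s t U,
        if q.1.1 = i then if q.edges = p then if q.edges ∈ A then x q else 0 else 0 else 0 := by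
    intro i
    rw [finsum_mem_def, finsum_eq_sum_of_support_subset
      (s := Finset.univ.image fun q : N.PathIn s t U => q.edges)]
    · refine Finset.sum_congr rfl fun p _ => ?_
      rw [Set.indicator_apply, flow]
      split_ifs with hp
      · refine Finset.sum_congr rfl fun q _ => ?_
        by_cases hq : q.edges = p
        · simp only [hq, and_true, if_pos hp, if_true]
        · simp only [hq, and_false, if_false, ite_self]
      · refine (Finset.sum_eq_zero fun q _ => ?_).symm
        by_cases hq : q.edges = p
        · simp only [hq, if_neg hp, ite_self]
        · simp only [hq, if_false, ite_self]
    · exact fun p hp => support_flow_subset x i fun h0 => hp (by simp [Set.indicator_apply, h0])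
  rw [Finset.sum_congr rfl fun i _ => (h1 i).trans Finset.sum_comm, Finset.sum_comm]
  refine Finset.sum_congr rfl fun q _ => ?_
  rw [Finset.sum_eq_single_of_mem q.1.1 (Finset.mem_univ _), Finset.sum_eq_single_of_mem q.edges]
  · simp only [if_true]
  · exact Finset.mem_image_of_mem _ (Finset.mem_univ q)
  · exact fun p _ hp => by simp only [hp.symm, if_false, ite_self]
  · exact fun i _ hi => by simp only [hi.symm, if_false, Finset.sum_const_zero]

theorem edgeFlow_flow (x : N.PathIn s t U → ℝ) (e : E) :
    N.edgeFlow (flow x) e = ∑ q : N.PathIn s t U, if e ∈ q.edges then x q else 0 :=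
  (sum_finsum_flow x {p | e ∈ p}).trans
    (Finset.sum_congr rfl fun _ _ => by
      rw [Set.mem_ofPred_eq]
      congr)

theorem sum_rate_flow (x : N.PathIn s t U → ℝ) : ∑ i, rate (flow x) i = ∑ q, x q := by
  have h1 := sum_finsum_flow x Set.univ
  simp only [Set.mem_univ, if_true, finsum_true] at h1
  exact h1

theorem sum_edgeFlow_flow (x : N.PathIn s t U → ℝ) {S W : Finset E} (hSW : S ⊆ W) :
    ∑ e ∈ S, N.edgeFlow (flow x) e = ∑ q, count (S ∩ (W ∩ U)) q * x q := by
  rw [← Finset.inter_assoc, Finset.inter_eq_left.2 hSW]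
  simp only [edgeFlow_flow, count, Finset.sum_mul]
  rw [Finset.sum_comm]
  refine Finset.sum_congr rfl fun q _ => ?_
  simp only [ite_mul, one_mul, zero_mul]
  refine (Finset.sum_subset Finset.inter_subset_left fun e he he' => if_neg fun heq => ?_).symm
  exact he' (Finset.mem_inter.2 ⟨he, q.2.2 e heq⟩)

theorem sum_le_of_capacity {ρ : Finset E → ℝ} {S W : Finset E} (hSW : S ⊆ W) (h0 : 0 ≤ ρ S)
    (hmono : ρ (S ∩ (W ∩ U)) ≤ ρ S) {x : N.PathIn s t U → ℝ}
    (hx : ∑ q, count (S ∩ (W ∩ U)) q * x q ≤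
      if (S ∩ (W ∩ U)).Nonempty then ρ (S ∩ (W ∩ U)) else 1) :
    ∑ e ∈ S, N.edgeFlow (flow x) e ≤ ρ S := by
  rw [sum_edgeFlow_flow x hSW]
  split_ifs at hx with hne
  · exact hx.trans hmono
  · rw [Finset.not_nonempty_iff_eq_empty.1 hne]
    simpa [count] using h0

theorem sum_le_maxThroughput (hst : ∀ i, s i ≠ t i) {x : N.PathIn s t U → ℝ} (hx : ∀ q, 0 ≤ x q)
    (hM : ∀ v S, ∑ q, count (S ∩ (N.inE v ∩ U)) q * x q ≤
      if (S ∩ (N.inE v ∩ U)).Nonempty then N.rhoM v (S ∩ (N.inE v ∩ U)) else 1)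
    (hP : ∀ v S, ∑ q, count (S ∩ (N.outE v ∩ U)) q * x q ≤
      if (S ∩ (N.outE v ∩ U)).Nonempty then N.rhoP v (S ∩ (N.outE v ∩ U)) else 1) :
    ∑ q, x q ≤ N.maxThroughput s t := by
  refine le_csSup (N.bddAbove_throughput hst) ⟨flow x, ⟨fun i p => ?_, fun i p hp => ?_,
    fun i => (Finset.finite_toSet _).subset (support_flow_subset x i), fun v S hS => ?_,
    fun v S hS => ?_⟩, (sum_rate_flow x).symm⟩
  · refine Finset.sum_nonneg fun q _ => ?_
    split_ifs
    exacts [hx q, le_rfl]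
  · obtain ⟨q, rfl, rfl⟩ := exists_of_flow_ne_zero hp
    exact q.2.1
  · exact sum_le_of_capacity hS (N.rhoM_nonneg v S hS)
      (N.rhoM_mono v _ _ Finset.inter_subset_left hS) (hM v S)
  · exact sum_le_of_capacity hS (N.rhoP_nonneg v S hS)
      (N.rhoP_mono v _ _ Finset.inter_subset_left hS) (hP v S)

end PathIn

theorem maxThroughput_nonneg (N : DirPolyNet V E) {ι : Type} [Fintype ι] (s t : ι → V) :
    0 ≤ N.maxThroughput s t := by
  refine Real.sSup_nonneg ?_
  rintro _ ⟨f, hf, rfl⟩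
  exact Finset.sum_nonneg fun i _ => finsum_nonneg fun p => hf.nonneg i p

/-- A nearly optimal fractional multicut, given by weights on the vertex sets. -/
theorem exists_weights (N : DirPolyNet V E) {ι : Type} [Fintype ι] {s t : ι → V}
    (hst : ∀ i, s i ≠ t i) (U : Finset E)
    (hM : ∀ e ∈ U, 1 ≤ N.rhoM (N.head e) {e}) (hP : ∀ e ∈ U, 1 ≤ N.rhoP (N.tail e) {e}) :
    ∃ yM yP : V → Finset E → ℝ, (∀ v S, 0 ≤ yM v S) ∧ (∀ v S, 0 ≤ yP v S) ∧
      ∑ v, ((∑ S, yM v S * N.rhoM v (S ∩ (N.inE v ∩ U))) +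
        ∑ S, yP v S * N.rhoP v (S ∩ (N.outE v ∩ U))) ≤ 2 * N.maxThroughput s t + 1 / 2 ∧
      ∀ i p, N.IsPath (s i) (t i) p → (∀ e ∈ p, e ∈ U) →
        1 ≤ (p.map fun e => load N.head yM e + load N.tail yP e).sum := by
  let WM : V × Finset E → Finset E := fun j => j.2 ∩ (N.inE j.1 ∩ U)
  let WP : V × Finset E → Finset E := fun j => j.2 ∩ (N.outE j.1 ∩ U)
  let bM : V × Finset E → ℝ := fun j => if (WM j).Nonempty then N.rhoM j.1 (WM j) else 1
  let bP : V × Finset E → ℝ := fun j => if (WP j).Nonempty then N.rhoP j.1 (WP j) else 1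
  have hWM : ∀ j, WM j ⊆ N.inE j.1 := fun j =>
    Finset.inter_subset_right.trans Finset.inter_subset_left
  have hWP : ∀ j, WP j ⊆ N.outE j.1 := fun j =>
    Finset.inter_subset_right.trans Finset.inter_subset_left
  have hbM : ∀ j, 0 < bM j := fun j => by
    simp only [bM]
    split_ifs with h
    · obtain ⟨e, he⟩ := h
      have heW := he
      simp only [WM, inE, Finset.mem_inter, Finset.mem_filter] at heW
      have h1 := hM e heW.2.2
      rw [heW.2.1.2] at h1
      have h2 := N.rhoM_mono j.1 {e} (WM j) (by simpa using he) (hWM j)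
      linarith
    · exact one_pos
  have hbP : ∀ j, 0 < bP j := fun j => by
    simp only [bP]
    split_ifs with h
    · obtain ⟨e, he⟩ := h
      have heW := he
      simp only [WP, outE, Finset.mem_inter, Finset.mem_filter] at heW
      have h1 := hP e heW.2.2
      rw [heW.2.1.2] at h1
      have h2 := N.rhoP_mono j.1 {e} (WP j) (by simpa using he) (hWP j)
      linarith
    · exact one_pos
  have hρM : ∀ j, N.rhoM j.1 (WM j) ≤ bM j := fun j => by
    simp only [bM]
    split_ifs with h
    · exact le_rfl
    · rw [Finset.not_nonempty_iff_eq_empty.1 h, N.rhoM_empty]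
      exact zero_le_one
  have hρP : ∀ j, N.rhoP j.1 (WP j) ≤ bP j := fun j => by
    simp only [bP]
    split_ifs with h
    · exact le_rfl
    · rw [Finset.not_nonempty_iff_eq_empty.1 h, N.rhoP_empty]
      exact zero_le_one
  obtain ⟨y, hy, hcost, hcov⟩ := exists_fractional_cover
    (Sum.elim (fun j (q : N.PathIn s t U) => PathIn.count (WM j) q)
      (fun j q => PathIn.count (WP j) q)) (Sum.elim bM bP)
    (fun j => by
      cases j
      exacts [hbM _, hbP _])
    (N.maxThroughput s t) (N.maxThroughput_nonneg s t)
    (fun x hx hj => PathIn.sum_le_maxThroughput hst hx (fun v S => hj (Sum.inl (v, S)))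
      (fun v S => hj (Sum.inr (v, S))))
  rw [Fintype.sum_sum_type] at hcost
  refine ⟨fun v S => y (Sum.inl (v, S)), fun v S => y (Sum.inr (v, S)), fun v S => hy _,
    fun v S => hy _, le_trans ?_ hcost, fun i p hp hpU => ?_⟩
  · rw [Finset.sum_add_distrib, ← Fintype.sum_prod_type', ← Fintype.sum_prod_type']
    exact add_le_add
      (Finset.sum_le_sum fun j _ => mul_le_mul_of_nonneg_left (hρM j) (hy _))
      (Finset.sum_le_sum fun j _ => mul_le_mul_of_nonneg_left (hρP j) (hy _))
  · let q : N.PathIn s t U := ⟨(i, ⟨p, hp.nodup⟩), hp, hpU⟩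
    have h1 := hcov q
    rw [Fintype.sum_sum_type, Fintype.sum_prod_type, Fintype.sum_prod_type] at h1
    have h2 := PathIn.sum_mul_count N.head (fun v S => y (Sum.inl (v, S))) N.inE
      (fun v e he => by simpa [inE] using he) (N.sum_inE U) q
    have h3 := PathIn.sum_mul_count N.tail (fun v S => y (Sum.inr (v, S))) N.outE
      (fun v e he => by simpa [outE] using he) (N.sum_outE U) q
    rw [List.sum_map_add]
    exact h1.trans_eq (congrArg₂ (· + ·) h2 h3)

/-- The edges of zero capacity can be cut for free. -/
theorem splitCost_zero_le (N : DirPolyNet V E) :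
    N.splitCost (Finset.univ.filter fun e => N.rhoM (N.head e) {e} = 0)
      (Finset.univ.filter fun e => N.rhoP (N.tail e) {e} = 0) ≤ 0 := by
  have key : ∀ (ρ : Finset E → ℝ) (W : Finset E), ρ ∅ = 0 →
      (∀ A B, A ⊆ W → B ⊆ W → ρ (A ∪ B) ≤ ρ A + ρ B) → (∀ e ∈ W, ρ {e} = 0) → ρ W ≤ 0 := by
    intro ρ W h0 hsub hW
    induction W using Finset.induction_on with
    | empty => exact h0.le
    | insert e W _ ih =>
      have h1 := Finset.subset_insert e W
      have h2 := hsub {e} W (by simp) h1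
      have h3 := ih (fun A B hA hB => hsub A B (hA.trans h1) (hB.trans h1))
        fun f hf => hW f (h1 hf)
      have h4 := hW e (Finset.mem_insert_self e W)
      rw [Finset.insert_eq]
      linarith
  refine Finset.sum_nonpos fun v _ => add_nonpos ?_ ?_
  · refine key (N.rhoM v) _ (N.rhoM_empty v) (fun A B hA hB => N.rhoM_union_le
      (hA.trans Finset.inter_subset_left) (hB.trans Finset.inter_subset_left)) fun e he => ?_
    simp only [inE, Finset.mem_inter, Finset.mem_filter] at he
    rw [← he.1.2]
    exact he.2.2
  · refine key (N.rhoP v) _ (N.rhoP_empty v) (fun A B hA hB => N.rhoP_union_le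
      (hA.trans Finset.inter_subset_left) (hB.trans Finset.inter_subset_left)) fun e he => ?_
    simp only [outE, Finset.mem_inter, Finset.mem_filter] at he
    rw [← he.1.2]
    exact he.2.2

theorem one_le_of_integral {r : ℝ} (h : ∃ z : ℤ, r = z) (h0 : 0 ≤ r) (hne : r ≠ 0) : 1 ≤ r := by
  obtain ⟨z, rfl⟩ := h
  have h1 : (0 : ℤ) < z := lt_of_le_of_ne (by exact_mod_cast h0) fun h => hne (by simp [← h])
  exact_mod_cast h1

/-- The split form of the quadratic multicut bound for integer valued polymatroids. -/
theorem exists_split_le_sq (N : DirPolyNet V E) {ι : Type} [Fintype ι] {s t : ι → V}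
    (hst : ∀ i, s i ≠ t i) (hM : ∀ v A, A ⊆ N.inE v → ∃ z : ℤ, N.rhoM v A = z)
    (hP : ∀ v A, A ⊆ N.outE v → ∃ z : ℤ, N.rhoP v A = z) :
    ∃ X Y : Finset E, (∀ i, ¬ N.Conn (Finset.univ \ (X ∪ Y)) (s i) (t i)) ∧
      N.splitCost X Y ≤ 672 * N.maxThroughput s t ^ 2 := by
  set X₀ := Finset.univ.filter fun e => N.rhoM (N.head e) {e} = 0 with hX₀
  set Y₀ := Finset.univ.filter fun e => N.rhoP (N.tail e) {e} = 0 with hY₀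
  have hcost₀ : N.splitCost X₀ Y₀ ≤ 0 := N.splitCost_zero_le
  set U := Finset.univ \ (X₀ ∪ Y₀) with hU
  by_cases hc : ∃ i, N.Conn U (s i) (t i)
  · have hUne : ∀ e ∈ U, N.rhoM (N.head e) {e} ≠ 0 ∧ N.rhoP (N.tail e) {e} ≠ 0 := fun e he => by
      simpa [hU, hX₀, hY₀] using he
    have hUM : ∀ e ∈ U, 1 ≤ N.rhoM (N.head e) {e} := fun e he =>
      one_le_of_integral (hM _ _ (by simp [inE])) (N.rhoM_nonneg _ _ (by simp)) (hUne e he).1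
    have hUP : ∀ e ∈ U, 1 ≤ N.rhoP (N.tail e) {e} := fun e he =>
      one_le_of_integral (hP _ _ (by simp [outE])) (N.rhoP_nonneg _ _ (by simp)) (hUne e he).2
    obtain ⟨yM, yP, hyM, hyP, hy, hlong⟩ := N.exists_weights hst U hUM hUP
    obtain ⟨gM, gP, μM, μP, hcov, hmass⟩ := N.exists_isCover U hyM hyP hUM hUP
    obtain ⟨X, Y, hsep, hcost⟩ := hcov.exists_split_multicut s t hlong
    refine ⟨X₀ ∪ X, Y₀ ∪ Y, fun i => ?_, ?_⟩
    · rw [sdiff_union_union_union]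
      exact hsep i
    · obtain ⟨i, hi⟩ := hc
      obtain ⟨p, hp, hpU⟩ := hi.exists_path
      have h1 := hp.sum_le hcov.massM_nonneg hcov.massP_nonneg fun e he =>
        add_le_add (hcov.le_massM e (hpU e he)) (hcov.le_massP e (hpU e he))
      have h2 := hlong i p hp hpU
      have h3 := N.splitCost_union_le X₀ Y₀ X Y
      nlinarith
  · push Not at hc
    exact ⟨X₀, Y₀, hc, hcost₀.trans (by positivity)⟩

end DirPolyNet

/-- There is a universal constant `C` such that in every directed
polymatroidal network whose polymatroids are integer valued, for any multicommodity
flow instance with `k` source-sink pairs, there is a feasible multicut `F` with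
`ν(F) ≤ C·β²` where `β` is the maximum throughput flow. -/
theorem multicut_gap_integer_valued :
    ∃ C : ℝ, 0 < C ∧
      ∀ (V E : Type) [Fintype V] [Fintype E] [DecidableEq V] [DecidableEq E]
        (N : DirPolyNet V E) (k : ℕ) (s t : Fin k → V),
        (∀ i, s i ≠ t i) →
        (∀ v A, A ⊆ N.inE v → ∃ z : ℤ, N.rhoM v A = (z : ℝ)) →
        (∀ v A, A ⊆ N.outE v → ∃ z : ℤ, N.rhoP v A = (z : ℝ)) →
        ∃ F : Finset E, (∀ i, N.Separates F (s i) (t i)) ∧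
          N.cutCost F ≤ C * (N.maxThroughput s t) ^ 2 := by
  refine ⟨672, by norm_num, fun V E _ _ _ _ N k s t hst hM hP => ?_⟩
  obtain ⟨X, Y, hsep, hcost⟩ := N.exists_split_le_sq hst hM hP
  obtain ⟨F, hF, hFcost⟩ := N.exists_multicut_of_split s t X Y hsep
  exact ⟨F, hF, hFcost.trans hcost⟩
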